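/- arXiv:0707.0045 — 11 statements merged into one kernel-verified Lean document; each statement's English description precedes it below -/
import Mathlib

section
/- Let ν > 1 be a real number and let ξ : ℝ → ℝ be a differentiable function with 0 < ξ(y) < 1 and ξ'(y) = ξ(y)^(ν+1)·(1 − ξ(y)) for all y ∈ ℝ. Then ξ is strictly increasing, ξ(y) → 1 as y → +∞, ξ(y) → 0 as y → −∞, and the convergence at +∞ is exponential: for every c with 0 < c < 1 there exists C > 0 such that 1 − ξ(y) ≤ C·e^(−c·y) for all y ≥ 0. -/
open Filter

/-- One-sided Grönwall bound: a function `u` with `u' ≤ -k u` on `[a, ∞)` decays at rate `k`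
from `a` on. -/
lemma le_mul_exp_of_deriv_le {u : ℝ → ℝ} (hu : Differentiable ℝ u) {k a : ℝ}
    (h : ∀ y, a ≤ y → deriv u y ≤ -k * u y) {z : ℝ} (hz : a ≤ z) :
    u z ≤ u a * Real.exp (-k * (z - a)) := by
  have hd : ∀ y, HasDerivAt (fun y => u y * Real.exp (k * y))
      (deriv u y * Real.exp (k * y) + u y * (Real.exp (k * y) * k)) y := fun y =>
    (hu y).hasDerivAt.mul (by simpa using ((hasDerivAt_id y).const_mul k).exp)
  have hanti : AntitoneOn (fun y => u y * Real.exp (k * y)) (Set.Ici a) := by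
    refine antitoneOn_of_deriv_nonpos (convex_Ici a)
      (fun y _ => (hd y).continuousAt.continuousWithinAt)
      (fun y _ => (hd y).differentiableAt.differentiableWithinAt) fun y hy => ?_
    rw [interior_Ici] at hy
    rw [(hd y).deriv]
    nlinarith [h y (le_of_lt hy), Real.exp_pos (k * y)]
  have hle : u z * Real.exp (k * z) ≤ u a * Real.exp (k * a) :=
    hanti Set.self_mem_Ici hz hz
  have hsplit : Real.exp (-k * (z - a)) = Real.exp (k * a) / Real.exp (k * z) := by
    rw [← Real.exp_sub]; ring_nf
  rwa [hsplit, ← mul_div_assoc, le_div_iff₀ (Real.exp_pos _)]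

lemma one_sub_le_mul_exp_of_le_rpow {ν : ℝ} {ξ : ℝ → ℝ} (hξdiff : Differentiable ℝ ξ)
    (hξlt : ∀ y, ξ y < 1) (hode : ∀ y, deriv ξ y = ξ y ^ (ν + 1) * (1 - ξ y)) {k a : ℝ}
    (hk : ∀ y, a ≤ y → k ≤ ξ y ^ (ν + 1)) {z : ℝ} (hz : a ≤ z) :
    1 - ξ z ≤ (1 - ξ a) * Real.exp (-k * (z - a)) := by
  refine le_mul_exp_of_deriv_le (u := fun y => 1 - ξ y) (hξdiff.const_sub 1) (fun y hy => ?_) hz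
  rw [deriv_const_sub, hode]
  nlinarith [hk y hy, hξlt y]

/-- A Kull–Anisimov profile is strictly increasing, tends to `1` at `+∞` and to `0`
at `-∞`, and the convergence at `+∞` is exponential. -/
theorem stmt_5 (ν : ℝ) (hν : 1 < ν) (ξ : ℝ → ℝ)
    (hξdiff : Differentiable ℝ ξ)
    (hξpos : ∀ y, 0 < ξ y) (hξlt : ∀ y, ξ y < 1)
    (hode : ∀ y, deriv ξ y = ξ y ^ (ν + 1) * (1 - ξ y)) :
    StrictMono ξ ∧
    Tendsto ξ atTop (nhds 1) ∧
    Tendsto ξ atBot (nhds 0) ∧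
    ∀ c : ℝ, 0 < c → c < 1 → ∃ C > (0 : ℝ), ∀ y : ℝ, 0 ≤ y →
      1 - ξ y ≤ C * Real.exp (-c * y) := by
  have hmono : StrictMono ξ := strictMono_of_deriv_pos fun y => by
    rw [hode]
    exact mul_pos (Real.rpow_pos_of_pos (hξpos y) _) (sub_pos.2 (hξlt y))
  have hν' : 0 ≤ ν + 1 := by linarith
  have hpow : ∀ {x : ℝ}, 0 < x → ∀ {y : ℝ}, x ≤ ξ y → x ^ (ν + 1) ≤ ξ y ^ (ν + 1) :=
    fun hx _ hxy => Real.rpow_le_rpow hx.le hxy hν'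
  have htop : Tendsto ξ atTop (nhds 1) := by
    have hk : 0 < ξ 0 ^ (ν + 1) := Real.rpow_pos_of_pos (hξpos 0) _
    have hlim : Tendsto (fun y => 1 - (1 - ξ 0) * Real.exp (-ξ 0 ^ (ν + 1) * (y - 0)))
        atTop (nhds (1 - (1 - ξ 0) * 0)) := by
      refine ((Real.tendsto_exp_atBot.comp ?_).const_mul _).const_sub _
      simpa only [sub_zero, id] using tendsto_id.const_mul_atTop_of_neg (neg_lt_zero.2 hk)
    rw [mul_zero, sub_zero] at hlim
    refine tendsto_of_tendsto_of_tendsto_of_le_of_le' hlim tendsto_const_nhds ?_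
      (Eventually.of_forall fun y => (hξlt y).le)
    filter_upwards [eventually_ge_atTop 0] with y hy
    have := one_sub_le_mul_exp_of_le_rpow hξdiff hξlt hode
      (fun y hy => hpow (hξpos 0) (hmono.monotone hy)) hy
    linarith
  refine ⟨hmono, htop, ?_, fun c hc hc1 => ?_⟩
  · have hsmall : ∀ ε > 0, ∃ y, ξ y < ε := by
      intro ε hε
      by_contra! hge
      have hk : 0 < ε ^ (ν + 1) := Real.rpow_pos_of_pos hε _
      have hlim : Tendsto (fun y => Real.exp (ε ^ (ν + 1) * y)) atBot (nhds 0) :=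
        Real.tendsto_exp_atBot.comp (tendsto_id.const_mul_atBot hk)
      have hle : 1 - ξ 0 ≤ 0 := by
        refine ge_of_tendsto hlim ?_
        filter_upwards [eventually_le_atBot 0] with y hy
        have := one_sub_le_mul_exp_of_le_rpow hξdiff hξlt hode
          (fun y _ => hpow hε (hge y)) hy
        rw [zero_sub, neg_mul_neg] at this
        nlinarith [hξpos y, Real.exp_pos (ε ^ (ν + 1) * y)]
      linarith [hξlt 0]
    refine tendsto_order.2 ⟨fun b hb => Eventually.of_forall fun y => hb.trans (hξpos y),
      fun b hb => ?_⟩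
    obtain ⟨y₀, hy₀⟩ := hsmall b hb
    filter_upwards [eventually_le_atBot y₀] with y hy
    exact (hmono.monotone hy).trans_lt hy₀
  · have hev : ∀ᶠ y in atTop, c < ξ y ^ (ν + 1) := by
      have := htop.rpow_const (p := ν + 1) (Or.inl one_ne_zero)
      rw [Real.one_rpow] at this
      exact this.eventually (lt_mem_nhds hc1)
    obtain ⟨a, ha⟩ := eventually_atTop.1 hev
    refine ⟨Real.exp (c * a), Real.exp_pos _, fun y _ => ?_⟩
    rw [← Real.exp_add]
    rcases le_total a y with hay | hya
    · have hle := one_sub_le_mul_exp_of_le_rpow hξdiff hξlt hode (fun y hy => (ha y hy).le) hay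
      have harg : c * a + -c * y = -c * (y - a) := by ring
      rw [harg]
      nlinarith [hξpos a, Real.exp_pos (-c * (y - a))]
    · have := Real.one_le_exp (show 0 ≤ c * a + -c * y by nlinarith)
      linarith [hξpos y]
end

section
/- Let ν > 1 be a real number and let ξ₁, ξ₂ : ℝ → ℝ both be differentiable functions with values in the open interval (0,1) satisfying ξᵢ'(y) = ξᵢ(y)^(ν+1)·(1 − ξᵢ(y)) for all y ∈ ℝ (i = 1, 2). Then there exists c ∈ ℝ such that ξ₂(y) = ξ₁(y + c) for all y ∈ ℝ; that is, all such (non-constant) solutions differ by a translation. -/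
open Set

/-- A continuous function on an open interval has a primitive there. -/
theorem ContinuousOn.exists_hasDerivAt_Ioo {a b : ℝ} {f : ℝ → ℝ}
    (hf : ContinuousOn f (Ioo a b)) :
    ∃ F : ℝ → ℝ, ∀ x ∈ Ioo a b, HasDerivAt F (f x) x := by
  rcases (Ioo a b).eq_empty_or_nonempty with h | ⟨x₀, hx₀⟩
  · exact ⟨0, by simp [h]⟩
  refine ⟨fun x => ∫ t in x₀..x, f t, fun x hx => ?_⟩
  exact intervalIntegral.integral_hasDerivAt_right
    (hf.mono (ordConnected_Ioo.uIcc_subset hx₀ hx)).intervalIntegrable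
    (hf.stronglyMeasurableAtFilter isOpen_Ioo x hx)
    (hf.continuousAt (isOpen_Ioo.mem_nhds hx))

/-- Two global solutions of an autonomous scalar ODE that stay in an open interval on which the
vector field is continuous and positive differ by a translation. -/
theorem exists_eq_translate_of_hasDerivAt {a b : ℝ} {v f g : ℝ → ℝ}
    (hv : ContinuousOn v (Ioo a b)) (hpos : ∀ x ∈ Ioo a b, 0 < v x)
    (hf : ∀ y, f y ∈ Ioo a b) (hg : ∀ y, g y ∈ Ioo a b)
    (hf' : ∀ y, HasDerivAt f (v (f y)) y) (hg' : ∀ y, HasDerivAt g (v (g y)) y) :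
    ∃ c : ℝ, ∀ y : ℝ, g y = f (y + c) := by
  obtain ⟨G, hG⟩ := (hv.inv₀ fun x hx => (hpos x hx).ne').exists_hasDerivAt_Ioo
  have time {h : ℝ → ℝ} (hh : ∀ y, h y ∈ Ioo a b) (hh' : ∀ y, HasDerivAt h (v (h y)) y)
      (y : ℝ) : G (h y) = y + G (h 0) := by
    have hd (z : ℝ) : HasDerivAt (fun y => G (h y) - y) 0 z := by
      have key := ((hG _ (hh z)).comp z (hh' z)).sub (hasDerivAt_id z)
      rwa [Pi.inv_apply, inv_mul_cancel₀ (hpos _ (hh z)).ne', sub_self] at key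
    have := is_const_of_deriv_eq_zero (fun z => (hd z).differentiableAt)
      (fun z => (hd z).deriv) y 0
    linarith
  have hmono : StrictMonoOn G (Ioo a b) := by
    refine strictMonoOn_of_deriv_pos (convex_Ioo a b)
      (fun x hx => (hG x hx).continuousAt.continuousWithinAt) fun x hx => ?_
    rw [interior_Ioo] at hx
    rw [(hG x hx).deriv]
    exact inv_pos.2 (hpos x hx)
  refine ⟨G (g 0) - G (f 0), fun y => hmono.injOn (hg _) (hf _) ?_⟩
  rw [time hg hg', time hf hf']
  ring



/-- Any two solutions of the Kull–Anisimov ODE `ξ' = ξ^(ν+1)(1-ξ)` with values in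
`(0,1)` differ by a translation. -/
theorem stmt_6 (ν : ℝ) (hν : 1 < ν) (ξ₁ ξ₂ : ℝ → ℝ)
    (hdiff₁ : Differentiable ℝ ξ₁) (hdiff₂ : Differentiable ℝ ξ₂)
    (hpos₁ : ∀ y, 0 < ξ₁ y) (hlt₁ : ∀ y, ξ₁ y < 1)
    (hpos₂ : ∀ y, 0 < ξ₂ y) (hlt₂ : ∀ y, ξ₂ y < 1)
    (hode₁ : ∀ y, deriv ξ₁ y = ξ₁ y ^ (ν + 1) * (1 - ξ₁ y))
    (hode₂ : ∀ y, deriv ξ₂ y = ξ₂ y ^ (ν + 1) * (1 - ξ₂ y)) :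
    ∃ c : ℝ, ∀ y : ℝ, ξ₂ y = ξ₁ (y + c) := by
  refine exists_eq_translate_of_hasDerivAt (a := 0) (b := 1)
    (v := fun x => x ^ (ν + 1) * (1 - x)) ?_ ?_ (fun y => ⟨hpos₁ y, hlt₁ y⟩)
    (fun y => ⟨hpos₂ y, hlt₂ y⟩) (fun y => hode₁ y ▸ (hdiff₁ y).hasDerivAt)
    (fun y => hode₂ y ▸ (hdiff₂ y).hasDerivAt)
  · exact (continuousOn_id.rpow_const fun x hx => Or.inl hx.1.ne').mul (by fun_prop)
  · exact fun x hx => mul_pos (Real.rpow_pos_of_pos hx.1 _) (sub_pos.2 hx.2)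
end

section
/- Let ν > 1 be a real number and let ξ be a Kull–Anisimov profile. Then (−ν·y)^(1/ν)·ξ(y) → 1 as y → −∞. In particular, for ρ₀(x) = ρₐ·ξ(x/L₀) with ρₐ, L₀ > 0, the quantity (−x)^(1/ν)·ρ₀(x) tends to a strictly positive constant as x → −∞. -/
open Filter

/-- If the derivative of `f` tends to `c` at `-∞`, then so does `f x / x`. -/
theorem tendsto_div_id_atBot_of_hasDerivAt {f f' : ℝ → ℝ} {c : ℝ}
    (hf : ∀ x, HasDerivAt f (f' x) x) (hf' : Tendsto f' atBot (nhds c)) :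
    Tendsto (fun x => f x / x) atBot (nhds c) := by
  rw [Metric.tendsto_nhds]
  intro ε hε
  obtain ⟨b, hb⟩ := eventually_atBot.1 (Metric.tendsto_nhds.1 hf' (ε / 4) (by positivity))
  set A := |f b - c * b| with hA
  have hA0 : 0 ≤ A := abs_nonneg _
  filter_upwards [eventually_le_atBot b, eventually_le_atBot (-|b|), eventually_lt_atBot 0,
    eventually_le_atBot (-(4 * A / ε))] with x hxb hxb' hx0 hxA
  have hmv := (convex_Iic b).norm_image_sub_le_of_norm_hasDerivWithin_le
    (f := fun t => f t - c * t) (f' := fun t => f' t - c) (C := ε / 4) (x := b) (y := x)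
    (fun t _ => ((hf t).sub (by simpa using (hasDerivAt_id t).const_mul c)).hasDerivWithinAt)
    (fun t ht => (hb t ht).le) (Set.mem_Iic.2 le_rfl) hxb
  simp only [Real.norm_eq_abs] at hmv
  rw [abs_of_nonpos (sub_nonpos.2 hxb)] at hmv
  have hA4 : 4 * A ≤ ε * -x := by
    have := (div_le_iff₀ hε).1 (le_neg.1 hxA)
    linarith
  have hbx : b ≤ -x := (le_abs_self b).trans (le_neg.1 hxb')
  have htri : |f x - c * x| ≤ |f x - c * x - (f b - c * b)| + A := by
    simpa using abs_add_le (f x - c * x - (f b - c * b)) (f b - c * b)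
  have hlt : |f x - c * x| < ε * -x := by
    nlinarith [mul_pos hε (neg_pos.2 hx0), mul_le_mul_of_nonneg_left hbx hε.le]
  have hrw : f x / x - c = (f x - c * x) / x := by
    field_simp [hx0.ne]
  rw [Real.dist_eq, hrw, abs_div, abs_of_neg hx0, div_lt_iff₀ (neg_pos.2 hx0)]
  exact hlt

/-- A Kull–Anisimov profile vanishes at `-∞`. -/
theorem tendsto_atBot_zero_of_profile {ν : ℝ} (hν : 1 < ν) {ξ : ℝ → ℝ}
    (hξpos : ∀ y, 0 < ξ y) (hξlt : ∀ y, ξ y < 1)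
    (hder : ∀ y, HasDerivAt ξ (ξ y ^ (ν + 1) * (1 - ξ y)) y) :
    Tendsto ξ atBot (nhds 0) := by
  have hmono : Monotone ξ := monotone_of_deriv_nonneg (fun y => (hder y).differentiableAt)
    fun y => by
      rw [(hder y).deriv]
      exact mul_nonneg (Real.rpow_nonneg (hξpos y).le _) (sub_nonneg.2 (hξlt y).le)
  have hbdd : BddBelow (Set.range ξ) := ⟨0, by rintro _ ⟨y, rfl⟩; exact (hξpos y).le⟩
  have hlim := tendsto_atBot_ciInf hmono hbdd
  set l := ⨅ y, ξ y
  have hl1 : l < 1 := (ciInf_le hbdd 0).trans_lt (hξlt 0)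
  have hl0 : 0 ≤ l := le_ciInf fun y => (hξpos y).le
  have hslope := tendsto_div_id_atBot_of_hasDerivAt hder
    ((hlim.rpow_const (Or.inr (by linarith))).mul (hlim.const_sub 1))
  have hzero : Tendsto (fun y => ξ y / y) atBot (nhds 0) := by
    simpa [div_eq_mul_inv] using hlim.mul tendsto_inv_atBot_zero
  have heq := tendsto_nhds_unique hslope hzero
  rcases mul_eq_zero.1 heq with h | h
  · rwa [(Real.rpow_eq_zero hl0 (by linarith)).1 h] at hlim
  · linarith

theorem tendsto_rpow_mul_profile {ν : ℝ} (hν : 1 < ν) {ξ : ℝ → ℝ}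
    (hξpos : ∀ y, 0 < ξ y) (hξlt : ∀ y, ξ y < 1)
    (hder : ∀ y, HasDerivAt ξ (ξ y ^ (ν + 1) * (1 - ξ y)) y) :
    Tendsto (fun y : ℝ => (-(ν * y)) ^ (1 / ν) * ξ y) atBot (nhds 1) := by
  have hν0 : 0 < ν := by linarith
  have hu : ∀ y, HasDerivAt (fun t => ξ t ^ (-ν)) (-ν * (1 - ξ y)) y := fun y => by
    convert (hder y).rpow_const (p := -ν) (Or.inl (hξpos y).ne') using 1
    have h : ξ y ^ (ν + 1) * ξ y ^ (-ν - 1) = 1 := by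
      rw [← Real.rpow_add (hξpos y)]
      simp
    linear_combination ν * (1 - ξ y) * h
  have hlim := tendsto_div_id_atBot_of_hasDerivAt hu
    (((tendsto_atBot_zero_of_profile hν hξpos hξlt hder).const_sub 1).const_mul (-ν))
  have hratio : Tendsto (fun y => (ξ y ^ (-ν) / y / (-ν)) ^ (-(1 / ν))) atBot (nhds 1) := by
    have h := (hlim.div_const (-ν)).rpow_const (p := -(1 / ν))
      (Or.inl (by simp [hν0.ne']))
    simpa [hν0.ne'] using h
  refine hratio.congr' ?_
  filter_upwards [eventually_lt_atBot 0] with y hy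
  have hpos : 0 < -(ν * y) := by nlinarith
  have hrw : ξ y ^ (-ν) / y / (-ν) = ξ y ^ (-ν) / -(ν * y) := by
    rw [div_div]
    ring_nf
  rw [hrw, Real.div_rpow (Real.rpow_nonneg (hξpos y).le _) hpos.le,
    ← Real.rpow_mul (hξpos y).le, Real.rpow_neg hpos.le, div_inv_eq_mul, mul_comm]
  have : -ν * -(1 / ν) = 1 := by field_simp
  rw [this, Real.rpow_one]

/-- For a Kull–Anisimov profile, `(-ν y)^(1/ν) ξ(y) → 1` as `y → -∞`; consequently
for `ρ₀(x) = ρₐ ξ(x/L₀)` the quantity `(-x)^(1/ν) ρ₀(x)` tends to a strictly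
positive constant as `x → -∞`. -/
theorem stmt_7 (ν : ℝ) (hν : 1 < ν) (ξ : ℝ → ℝ)
    (hξdiff : Differentiable ℝ ξ)
    (hξpos : ∀ y, 0 < ξ y) (hξlt : ∀ y, ξ y < 1)
    (hode : ∀ y, deriv ξ y = ξ y ^ (ν + 1) * (1 - ξ y)) :
    Tendsto (fun y : ℝ => (-(ν * y)) ^ (1 / ν) * ξ y) atBot (nhds 1) ∧
    ∀ ρa L0 : ℝ, 0 < ρa → 0 < L0 → ∃ C > (0 : ℝ),
      Tendsto (fun x : ℝ => (-x) ^ (1 / ν) * (ρa * ξ (x / L0))) atBot (nhds C) := by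
  have hν0 : 0 < ν := by linarith
  have hmain := tendsto_rpow_mul_profile hν hξpos hξlt
    fun y => hode y ▸ (hξdiff y).hasDerivAt
  refine ⟨hmain, fun ρa L0 hρ hL => ⟨ρa * (L0 / ν) ^ (1 / ν), by positivity, ?_⟩⟩
  have hscaled := (hmain.comp (tendsto_id.atBot_div_const hL)).const_mul
    (ρa * (L0 / ν) ^ (1 / ν))
  rw [mul_one] at hscaled
  refine hscaled.congr' ?_
  filter_upwards [eventually_lt_atBot 0] with x hx
  have hx' : 0 < -(ν * (x / L0)) := by
    have := div_neg_of_neg_of_pos hx hL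
    nlinarith
  have hrw : -x = L0 / ν * -(ν * (x / L0)) := by field_simp
  rw [hrw, Real.mul_rpow (by positivity) hx'.le]
  simp only [Function.comp_apply, id]
  ring
end

section
/- Let ν > 1 be a real number and let ξ be a Kull–Anisimov profile. Then there exist t₀ > 0, ε₀ > 0 and M > 0 such that for all t ≥ t₀ and all ε with 0 < ε ≤ ε₀, one has |ε⁻¹·ξ(−t/ε)^ν·(1 − ξ(−t/ε)) − 1/(ν·t)| ≤ M·ε^(1/ν)·t^(−1−1/ν). (Equivalently, the function r(t, ε) defined by ε⁻¹·ξ(−t/ε)^ν·(1 − ξ(−t/ε)) = 1/(ν·t) + ε^(1/ν)·t^(−1−1/ν)·r(t, ε) is bounded for t ≥ t₀ and 0 < ε ≤ ε₀.) -/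
/-- A function with nonnegative derivative on `(0, ∞)`, continuous on `[0, ∞)`, is bounded below
by its value at `0`. -/
lemma le_of_hasDerivAt_nonneg {f f' : ℝ → ℝ} (hc : ContinuousOn f (Set.Ici 0))
    (hf : ∀ s, 0 < s → HasDerivAt f (f' s) s) (hf' : ∀ s, 0 < s → 0 ≤ f' s)
    {s : ℝ} (hs : 0 ≤ s) : f 0 ≤ f s := by
  have hmono : MonotoneOn f (Set.Ici 0) := by
    refine monotoneOn_of_deriv_nonneg (convex_Ici 0) hc ?_ ?_
    · intro x hx
      rw [interior_Ici] at hx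
      exact (hf x hx).differentiableAt.differentiableWithinAt
    · intro x hx
      rw [interior_Ici] at hx
      rw [(hf x hx).deriv]
      exact hf' x hx
  exact hmono Set.self_mem_Ici hs hs

/-- Asymptotics of a Kull–Anisimov profile at `-∞`. -/
lemma exists_abs_profile_sub_le (ν : ℝ) (hν : 1 < ν) (ξ : ℝ → ℝ)
    (hξdiff : Differentiable ℝ ξ)
    (hξpos : ∀ y, 0 < ξ y) (hξlt : ∀ y, ξ y < 1)
    (hode : ∀ y, deriv ξ y = ξ y ^ (ν + 1) * (1 - ξ y)) :
    ∃ M > (0 : ℝ), ∀ s : ℝ, 1 ≤ s →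
      |ξ (-s) ^ ν * (1 - ξ (-s)) - 1 / (ν * s)| ≤ M * s ^ (-1 - 1 / ν) := by
  have hν0 : 0 < ν := by linarith
  obtain ⟨p, hp⟩ : ∃ p, p = 1 / ν := ⟨_, rfl⟩
  have hp0 : 0 < p := by rw [hp]; positivity
  have hp1 : p < 1 := by rw [hp, div_lt_one hν0]; exact hν
  rw [← hp]
  have hmono : Monotone ξ := by
    refine monotone_of_deriv_nonneg hξdiff fun y => ?_
    rw [hode]
    exact mul_nonneg (Real.rpow_nonneg (hξpos y).le _) (by linarith [hξlt y])
  let g : ℝ → ℝ := fun s => ξ (-s) ^ (-ν)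
  have hgpos : ∀ s, 0 < g s := fun s => Real.rpow_pos_of_pos (hξpos _) _
  have hg : ∀ s, HasDerivAt g (ν * (1 - ξ (-s))) s := by
    intro s
    have h1 : HasDerivAt (fun s => ξ (-s)) (deriv ξ (-s) * (-1)) s :=
      (hξdiff (-s)).hasDerivAt.comp s (hasDerivAt_neg s)
    have h2 := h1.rpow_const (p := -ν) (Or.inl (hξpos (-s)).ne')
    convert h2 using 1
    have h3 : ξ (-s) ^ (ν + 1) * ξ (-s) ^ (-ν - 1) = 1 := by
      rw [← Real.rpow_add (hξpos _)]
      simp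
    rw [hode]
    linear_combination (-(ν * (1 - ξ (-s)))) * h3
  have hgc : Continuous g := continuous_iff_continuousAt.2 fun s => (hg s).continuousAt
  obtain ⟨c, hc⟩ : ∃ c, c = ν * (1 - ξ 0) := ⟨_, rfl⟩
  have hc0 : 0 < c := by rw [hc]; exact mul_pos hν0 (by linarith [hξlt 0])
  have hglow : ∀ s, 0 ≤ s → c * s ≤ g s := by
    intro s hs
    have := le_of_hasDerivAt_nonneg (f := fun s => g s - c * s)
      (f' := fun s => ν * (1 - ξ (-s)) - c * 1) (by fun_prop)
      (fun s _ => (hg s).sub ((hasDerivAt_id s).const_mul c))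
      (fun s hs => by
        have : ξ (-s) ≤ ξ 0 := hmono (by linarith)
        simp only [hc]
        nlinarith) hs
    simp only [mul_zero, sub_zero] at this
    linarith [hgpos 0]
  have hgup : ∀ s, 0 ≤ s → g s ≤ ν * s + g 0 := by
    intro s hs
    have := le_of_hasDerivAt_nonneg (f := fun s => ν * s - g s)
      (f' := fun s => ν * 1 - ν * (1 - ξ (-s))) (by fun_prop)
      (fun s _ => ((hasDerivAt_id s).const_mul ν).sub (hg s))
      (fun s hs => by nlinarith [hξpos (-s)]) hs
    simp only [mul_zero, zero_sub] at this
    linarith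
  obtain ⟨D, hD⟩ : ∃ D, D = c ^ (-p) := ⟨_, rfl⟩
  have hD0 : 0 < D := by rw [hD]; positivity
  have hξle : ∀ s, 0 < s → ξ (-s) ≤ D * s ^ (-p) := by
    intro s hs
    have h1 : ξ (-s) = g s ^ (-p) := by
      simp only [g]
      rw [← Real.rpow_mul (hξpos _).le, hp]
      have : -ν * -(1 / ν) = 1 := by field_simp
      rw [this, Real.rpow_one]
    rw [h1, hD, ← Real.mul_rpow hc0.le hs.le]
    exact Real.rpow_le_rpow_of_nonpos (by positivity) (hglow s hs.le) (by linarith)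
  obtain ⟨K, hK⟩ : ∃ K, K = ν * D / (1 - p) := ⟨_, rfl⟩
  have hp1' : 0 < 1 - p := by linarith
  have hK0 : 0 < K := by rw [hK]; positivity
  have hKp : K * (1 - p) = ν * D := by rw [hK]; field_simp
  have hglow' : ∀ s, 0 ≤ s → ν * s - K * s ^ (1 - p) ≤ g s := by
    intro s hs
    have := le_of_hasDerivAt_nonneg (f := fun s => g s - ν * s + K * s ^ (1 - p))
      (f' := fun s => ν * (1 - ξ (-s)) - ν * 1 + K * ((1 - p) * s ^ (1 - p - 1)))
      (by
        have : Continuous fun s : ℝ => s ^ (1 - p) := Real.continuous_rpow_const hp1'.le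
        fun_prop)
      (fun s hs => ((hg s).sub ((hasDerivAt_id s).const_mul ν)).add
        ((Real.hasDerivAt_rpow_const (Or.inl hs.ne')).const_mul K))
      (fun s hs => by
        have h1 := mul_le_mul_of_nonneg_left (hξle s hs) hν0.le
        have h2 : (1 - p - 1 : ℝ) = -p := by ring
        simp only [h2]
        rw [← mul_assoc, hKp]
        linarith) hs
    simp only [mul_zero, Real.zero_rpow hp1'.ne'] at this
    linarith [hgpos 0]
  have hg0 := hgpos 0
  refine ⟨(K + g 0 + ν * D) / (c * ν), by positivity, fun s hs => ?_⟩
  have hs0 : 0 < s := by linarith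
  have hx := hξle s hs0
  have hxpos := hξpos (-s)
  have hgs := hgpos s
  have e1 : s ^ (1 - p) = s * s ^ (-p) := by
    rw [sub_eq_add_neg, Real.rpow_add hs0, Real.rpow_one]
  have e2 : s ^ (-1 - p) = s ^ (1 - p) / (s * s) := by
    have : (-1 - p : ℝ) = -1 + -p := by ring
    rw [this, Real.rpow_add hs0, Real.rpow_neg_one, e1]
    field_simp
  have hone : 1 ≤ s ^ (1 - p) := Real.one_le_rpow hs hp1'.le
  have e3 : ξ (-s) ^ ν = (g s)⁻¹ := by
    simp only [g]
    rw [Real.rpow_neg hxpos.le, inv_inv]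
  have e4 : (g s)⁻¹ * (1 - ξ (-s)) - 1 / (ν * s)
      = ((ν * s - g s) - ν * s * ξ (-s)) / (g s * (ν * s)) := by
    field_simp
    ring
  have hnum : |(ν * s - g s) - ν * s * ξ (-s)| ≤ (K + g 0 + ν * D) * s ^ (1 - p) := by
    have h1 := hglow' s hs0.le
    have h2 := hgup s hs0.le
    have h3 : ν * s * ξ (-s) ≤ ν * D * s ^ (1 - p) := by
      rw [e1]
      have := mul_le_mul_of_nonneg_left hx (mul_pos hν0 hs0).le
      linarith
    have h4 : 0 ≤ ν * s * ξ (-s) := by positivity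
    have h5 : g 0 ≤ g 0 * s ^ (1 - p) := le_mul_of_one_le_right hg0.le hone
    have h6 : 0 < K * s ^ (1 - p) := by positivity
    have h7 : 0 < ν * D * s ^ (1 - p) := by positivity
    rw [abs_le]
    constructor <;> linarith
  rw [e3, e4, abs_div, abs_of_pos (show 0 < g s * (ν * s) by positivity), e2]
  calc _ ≤ (K + g 0 + ν * D) * s ^ (1 - p) / (c * s * (ν * s)) := by
        gcongr
        exact hglow s hs0.le
    _ = _ := by field_simp

/-- For a Kull–Anisimov profile `ξ` there are `t₀ > 0`, `ε₀ > 0` and `M > 0` such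
that for `t ≥ t₀` and `0 < ε ≤ ε₀`,
`|ε⁻¹ ξ(-t/ε)^ν (1 - ξ(-t/ε)) - 1/(ν t)| ≤ M ε^(1/ν) t^(-1-1/ν)`. -/
theorem stmt_8 (ν : ℝ) (hν : 1 < ν) (ξ : ℝ → ℝ)
    (hξdiff : Differentiable ℝ ξ)
    (hξpos : ∀ y, 0 < ξ y) (hξlt : ∀ y, ξ y < 1)
    (hode : ∀ y, deriv ξ y = ξ y ^ (ν + 1) * (1 - ξ y)) :
    ∃ t₀ > (0 : ℝ), ∃ ε₀ > (0 : ℝ), ∃ M > (0 : ℝ),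
      ∀ t : ℝ, t₀ ≤ t → ∀ ε : ℝ, 0 < ε → ε ≤ ε₀ →
        |ε⁻¹ * ξ (-t / ε) ^ ν * (1 - ξ (-t / ε)) - 1 / (ν * t)|
          ≤ M * ε ^ (1 / ν) * t ^ (-1 - 1 / ν) := by
  obtain ⟨M, hM, h⟩ := exists_abs_profile_sub_le ν hν ξ hξdiff hξpos hξlt hode
  refine ⟨1, one_pos, 1, one_pos, M, hM, fun t ht ε hε hε1 => ?_⟩
  have ht0 : 0 < t := by linarith
  have hs := h (t / ε) ((one_le_div hε).2 (hε1.trans ht))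
  rw [neg_div]
  have e1 : ε⁻¹ * ξ (-(t / ε)) ^ ν * (1 - ξ (-(t / ε))) - 1 / (ν * t)
      = ε⁻¹ * (ξ (-(t / ε)) ^ ν * (1 - ξ (-(t / ε))) - 1 / (ν * (t / ε))) := by
    field_simp
  have e2 : M * ε ^ (1 / ν) * t ^ (-1 - 1 / ν) = ε⁻¹ * (M * (t / ε) ^ (-1 - 1 / ν)) := by
    have h1 : (-1 - 1 / ν : ℝ) = -(1 + 1 / ν) := by ring
    rw [Real.div_rpow ht0.le hε.le, h1, Real.rpow_neg hε.le, Real.rpow_add hε, Real.rpow_one]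
    field_simp
  rw [e1, e2, abs_mul, abs_of_pos (inv_pos.2 hε)]
  exact mul_le_mul_of_nonneg_left hs (inv_pos.2 hε).le
end

section
/- Let ν > 1 be a real number, let ξ be a Kull–Anisimov profile, and let ξ⁻¹ : (0,1) → ℝ denote its inverse. Then for every fixed R > 0, the quantity ε·ξ⁻¹((ε·R)^(1/ν)) converges to −1/(ν·R) as ε → 0⁺. -/
open Filter Topology

/-- Along a profile, `ξ ^ (-ν) + c y` has derivative `c - ν (1 - ξ)`. -/
lemma hasDerivAt_profile_rpow_neg_add {ν : ℝ} {ξ : ℝ → ℝ}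
    (hξdiff : Differentiable ℝ ξ) (hξpos : ∀ y, 0 < ξ y)
    (hode : ∀ y, deriv ξ y = ξ y ^ (ν + 1) * (1 - ξ y)) (c y : ℝ) :
    HasDerivAt (fun y => ξ y ^ (-ν) + c * y) (c - ν * (1 - ξ y)) y := by
  have h := ((hξdiff y).hasDerivAt.rpow_const (p := -ν) (Or.inl (hξpos y).ne')).add
    ((hasDerivAt_id y).const_mul c)
  refine h.congr_deriv ?_
  have h1 : ξ y ^ (ν + 1) * ξ y ^ (-ν - 1) = 1 := by
    rw [← Real.rpow_add (hξpos y)]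
    simp
  rw [hode]
  linear_combination (-ν * (1 - ξ y)) * h1

theorem stmt_9 (ν : ℝ) (hν : 1 < ν) (ξ : ℝ → ℝ)
    (hξdiff : Differentiable ℝ ξ)
    (hξpos : ∀ y, 0 < ξ y) (hξlt : ∀ y, ξ y < 1)
    (hode : ∀ y, deriv ξ y = ξ y ^ (ν + 1) * (1 - ξ y))
    (g : ℝ → ℝ) (hg : ∀ y : ℝ, g (ξ y) = y)
    (hg' : ∀ x : ℝ, 0 < x → x < 1 → ξ (g x) = x)
    (R : ℝ) (hR : 0 < R) :
    Tendsto (fun ε : ℝ => ε * g ((ε * R) ^ (1 / ν)))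
      (𝓝[>] 0) (𝓝 (-(1 / (ν * R)))) := by
  have hν0 : 0 < ν := by linarith
  have hmono : StrictMono ξ := strictMono_of_deriv_pos fun y => by
    rw [hode]
    exact mul_pos (Real.rpow_pos_of_pos (hξpos y) _) (sub_pos.2 (hξlt y))
  have hder := hasDerivAt_profile_rpow_neg_add hξdiff hξpos hode
  have hx : Tendsto (fun ε : ℝ => (ε * R) ^ (1 / ν)) (𝓝[>] 0) (𝓝 0) := by
    have h : ContinuousAt (fun ε : ℝ => (ε * R) ^ (1 / ν)) 0 :=
      (continuousAt_id.mul continuousAt_const).rpow_const (Or.inr (by positivity))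
    have h0 : (0 : ℝ) ^ (1 / ν) = 0 := Real.zero_rpow (by positivity)
    have h2 := h.tendsto
    simp only [zero_mul, h0] at h2
    exact h2.mono_left nhdsWithin_le_nhds
  have hsmall : ∀ δ, 0 < δ → δ < 1 → ∀ᶠ ε : ℝ in 𝓝[>] 0,
      0 < ε ∧ g ((ε * R) ^ (1 / ν)) ≤ g δ ∧
        ε * ξ (g ((ε * R) ^ (1 / ν))) ^ (-ν) = 1 / R := by
    intro δ h0 h1
    filter_upwards [self_mem_nhdsWithin, hx.eventually_lt_const h0] with ε hε hlt
    have hε : 0 < ε := hε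
    have hpos : 0 < (ε * R) ^ (1 / ν) := by positivity
    have hξg := hg' _ hpos (hlt.trans h1)
    refine ⟨hε, hmono.le_iff_le.1 (by rw [hξg, hg' δ h0 h1]; exact hlt.le), ?_⟩
    rw [hξg, ← Real.rpow_mul (by positivity)]
    have : 1 / ν * -ν = -1 := by field_simp
    rw [this, Real.rpow_neg_one]
    field_simp
  have hlim : ∀ k c : ℝ, Tendsto (fun ε : ℝ => (ε * k - 1 / R) / c) (𝓝[>] 0)
      (𝓝 (-(1 / (c * R)))) := by
    intro k c
    have h : Continuous fun ε : ℝ => (ε * k - 1 / R) / c := by fun_prop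
    have h2 := (h.tendsto 0).mono_left (nhdsWithin_le_nhds (s := Set.Ioi 0))
    convert h2 using 2
    rw [zero_mul, zero_sub, neg_div, div_div, mul_comm]
  rw [tendsto_order]
  constructor
  · intro a ha
    obtain ⟨δ, hδa, hδ0, hδ1⟩ : ∃ δ : ℝ, a < -(1 / (ν * (1 - δ) * R)) ∧ 0 < δ ∧ δ < 1 := by
      have h : ContinuousAt (fun δ : ℝ => -(1 / (ν * (1 - δ) * R))) 0 := by
        refine (ContinuousAt.div continuousAt_const (by fun_prop) ?_).neg
        simp [hν0.ne', hR.ne']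
      have h2 := (h.eventually (lt_mem_nhds (by simpa using ha))).filter_mono
        (nhdsWithin_le_nhds (s := Set.Ioi 0))
      exact (h2.and (Ioo_mem_nhdsGT one_pos)).exists
    have hc : 0 < ν * (1 - δ) := mul_pos hν0 (by linarith)
    have hanti : AntitoneOn (fun y => ξ y ^ (-ν) + ν * (1 - δ) * y) (Set.Iic (g δ)) := by
      refine antitoneOn_of_deriv_nonpos (convex_Iic _)
        (fun y _ => (hder _ y).continuousAt.continuousWithinAt)
        (fun y _ => (hder _ y).differentiableAt.differentiableWithinAt) fun y hy => ?_
      rw [interior_Iic] at hy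
      have hlt : ξ y < δ := by simpa [hg' δ hδ0 hδ1] using hmono hy
      rw [(hder _ y).deriv]
      nlinarith
    filter_upwards [hsmall δ hδ0 hδ1,
      (hlim (ξ (g δ) ^ (-ν) + ν * (1 - δ) * g δ) (ν * (1 - δ))).eventually_const_lt hδa]
      with ε ⟨hε, hle, heq⟩ hlt
    refine hlt.trans_le ?_
    rw [div_le_iff₀ hc]
    have := mul_le_mul_of_nonneg_left (hanti hle Set.self_mem_Iic hle) hε.le
    linarith
  · intro b hb
    have hm : Monotone fun y => ξ y ^ (-ν) + ν * y := by
      refine monotone_of_deriv_nonneg (fun y => (hder _ y).differentiableAt) fun y => ?_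
      rw [(hder _ y).deriv]
      nlinarith [mul_pos hν0 (hξpos y)]
    filter_upwards [hsmall (ξ 0) (hξpos 0) (hξlt 0),
      (hlim (ξ (g (ξ 0)) ^ (-ν) + ν * g (ξ 0)) ν).eventually_lt_const hb]
      with ε ⟨hε, hle, heq⟩ hlt
    refine lt_of_le_of_lt ?_ hlt
    rw [le_div_iff₀ hν0]
    have := mul_le_mul_of_nonneg_left (hm hle) hε.le
    linarith
end

section
/- Let ν > 1 be a real number, let ξ be a Kull–Anisimov profile, and let ε > 0 and λ ∈ ℝ. Then there exists a unique C¹ solution (U, V) : ℝ → ℝ² of the linear system U'(y) = ε·(1 − λ)·U(y) + (ε/ξ(y))·V(y), V'(y) = ε·(λ + 1)·V(y) + ε·(1 − λ²)·ξ(y)·U(y), such that (U(y), V(y)) → (1, λ − 1) as y → +∞. -/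
open Filter

open MeasureTheory Set Topology BoundedContinuousFunction

/-- The solution `Z` of `Z' = a Z - f` given by integrating `f` against `exp (a (y - s))` over
`s > y`. -/
noncomputable def expTail (a : ℝ) (f : ℝ → ℝ) (y : ℝ) : ℝ :=
  Real.exp (a * y) * ∫ s in Ioi y, Real.exp (-(a * s)) * f s

theorem hasDerivAt_integral_Ioi {f : ℝ → ℝ} (hf : Continuous f)
    (hint : ∀ y, IntegrableOn f (Ioi y)) (y : ℝ) :
    HasDerivAt (fun y => ∫ s in Ioi y, f s) (-f y) y := by
  have h : (fun y => ∫ s in Ioi y, f s) = fun y => (∫ s in Ioi 0, f s) - ∫ s in (0 : ℝ)..y, f s := by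
    funext z
    rw [← intervalIntegral.integral_interval_add_Ioi (hint 0) (hint z)]
    ring
  rw [h]
  exact (hf.integral_hasStrictDerivAt 0 y).hasDerivAt.const_sub _

theorem integrableOn_exp_neg_mul {a : ℝ} (ha : 0 ≤ a) {f : ℝ → ℝ} (hf : Continuous f) {y : ℝ}
    (hint : IntegrableOn f (Ioi y)) :
    IntegrableOn (fun s => Real.exp (-(a * s)) * f s) (Ioi y) := by
  refine Integrable.mono' (hint.norm.const_mul (Real.exp (-(a * y)))) (by fun_prop) ?_
  filter_upwards [ae_restrict_mem measurableSet_Ioi] with s hs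
  rw [norm_mul, Real.norm_eq_abs, Real.abs_exp]
  have : a * y ≤ a * s := mul_le_mul_of_nonneg_left (le_of_lt hs) ha
  gcongr

theorem hasDerivAt_expTail {a : ℝ} (ha : 0 ≤ a) {f : ℝ → ℝ} (hf : Continuous f)
    (hint : ∀ y, IntegrableOn f (Ioi y)) (y : ℝ) :
    HasDerivAt (expTail a f) (a * expTail a f y - f y) y := by
  have h1 := hasDerivAt_integral_Ioi (f := fun s => Real.exp (-(a * s)) * f s) (by fun_prop)
    (fun y => integrableOn_exp_neg_mul ha hf (hint y)) y
  have h2 : HasDerivAt (fun y => Real.exp (a * y)) (Real.exp (a * y) * (a * 1)) y :=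
    ((hasDerivAt_id y).const_mul a).exp
  refine (h2.mul h1).congr_deriv ?_
  have h3 : Real.exp (a * y) * Real.exp (-(a * y)) = 1 := by rw [← Real.exp_add]; simp
  unfold expTail
  linear_combination (-f y) * h3

theorem abs_expTail_le {a K : ℝ} (ha : 0 ≤ a) {f g : ℝ → ℝ} {y : ℝ}
    (hg : IntegrableOn g (Ioi y)) (hfg : ∀ s, |f s| ≤ K * g s) :
    |expTail a f y| ≤ K * ∫ s in Ioi y, g s := by
  have h1 : ‖∫ s in Ioi y, Real.exp (-(a * s)) * f s‖ ≤
      ∫ s in Ioi y, Real.exp (-(a * y)) * (K * g s) := by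
    refine norm_integral_le_of_norm_le ((hg.const_mul K).const_mul _) ?_
    filter_upwards [ae_restrict_mem measurableSet_Ioi] with s hs
    rw [norm_mul, Real.norm_eq_abs, Real.abs_exp, Real.norm_eq_abs]
    have : a * y ≤ a * s := mul_le_mul_of_nonneg_left (le_of_lt hs) ha
    have := hfg s
    gcongr
  rw [integral_const_mul, integral_const_mul, Real.norm_eq_abs] at h1
  have h3 : Real.exp (a * y) * Real.exp (-(a * y)) = 1 := by rw [← Real.exp_add]; simp
  rw [expTail, abs_mul, Real.abs_exp]
  calc _ ≤ Real.exp (a * y) * (Real.exp (-(a * y)) * (K * ∫ s in Ioi y, g s)) := by gcongr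
    _ = _ := by rw [← mul_assoc, h3, one_mul]

theorem expTail_sub {a : ℝ} (ha : 0 ≤ a) {f g : ℝ → ℝ} (hf : Continuous f) (hg : Continuous g)
    {y : ℝ} (hfi : IntegrableOn f (Ioi y)) (hgi : IntegrableOn g (Ioi y)) :
    expTail a (fun s => f s - g s) y = expTail a f y - expTail a g y := by
  simp only [expTail, mul_sub]
  rw [integral_sub (integrableOn_exp_neg_mul ha hf hfi) (integrableOn_exp_neg_mul ha hg hgi)]
  ring

/-- An increasing front: a nondecreasing `C¹` function with values in `(0, 1)`, tending to `1`
at `+∞`, with derivative `g`. -/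
structure IsFront (ξ g : ℝ → ℝ) : Prop where
  hasDerivAt : ∀ y, HasDerivAt ξ (g y) y
  continuous_deriv : Continuous g
  nonneg : ∀ y, 0 ≤ g y
  pos : ∀ y, 0 < ξ y
  lt_one : ∀ y, ξ y < 1
  tendsto : Tendsto ξ atTop (𝓝 1)

namespace IsFront

variable {ξ g : ℝ → ℝ}

theorem continuous (h : IsFront ξ g) : Continuous ξ :=
  continuous_iff_continuousAt.2 fun y => (h.hasDerivAt y).continuousAt

/-- The density `ξ' / ξ ^ (k + 2)`. -/
noncomputable def density (ξ g : ℝ → ℝ) (k : ℕ) (y : ℝ) : ℝ := g y * (ξ y)⁻¹ ^ (k + 2)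

theorem continuous_density (h : IsFront ξ g) (k : ℕ) : Continuous (density ξ g k) :=
  h.continuous_deriv.mul ((h.continuous.inv₀ fun y => (h.pos y).ne').pow _)

theorem density_nonneg (h : IsFront ξ g) (k : ℕ) (y : ℝ) : 0 ≤ density ξ g k y :=
  mul_nonneg (h.nonneg y) (pow_nonneg (inv_nonneg.2 (h.pos y).le) _)

theorem hasDerivAt_primitive (h : IsFront ξ g) (k : ℕ) (y : ℝ) :
    HasDerivAt (fun y => -((ξ y)⁻¹ ^ (k + 1) / (k + 1))) (density ξ g k y) y := by
  have hp := (h.pos y).ne'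
  refine ((((h.hasDerivAt y).inv hp).pow (k + 1)).div_const (k + 1 : ℝ)).neg.congr_deriv ?_
  have hk : (k + 1 : ℝ) ≠ 0 := by positivity
  simp only [density, Pi.inv_apply, inv_pow, Nat.add_sub_cancel]
  push_cast
  field_simp
  ring

theorem tendsto_primitive (h : IsFront ξ g) (k : ℕ) :
    Tendsto (fun y => -((ξ y)⁻¹ ^ (k + 1) / (k + 1 : ℝ))) atTop (𝓝 (-(1 / (k + 1)))) := by
  have := (((h.tendsto.inv₀ one_ne_zero).pow (k + 1)).div_const (k + 1 : ℝ)).neg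
  simpa using this

theorem integrableOn_density (h : IsFront ξ g) (k : ℕ) (y : ℝ) :
    IntegrableOn (density ξ g k) (Ioi y) :=
  integrableOn_Ioi_deriv_of_nonneg' (fun s _ => h.hasDerivAt_primitive k s)
    (fun s _ => h.density_nonneg k s) (h.tendsto_primitive k)

theorem integral_density (h : IsFront ξ g) (k : ℕ) (y : ℝ) :
    ∫ s in Ioi y, density ξ g k s = ((ξ y)⁻¹ ^ (k + 1) - 1) / (k + 1) := by
  rw [integral_Ioi_of_hasDerivAt_of_nonneg' (fun s _ => h.hasDerivAt_primitive k s)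
    (fun s _ => h.density_nonneg k s) (h.tendsto_primitive k)]
  ring

theorem abs_density_mul_le (h : IsFront ξ g) (k : ℕ) (u : ℝ →ᵇ ℝ) (s : ℝ) :
    |density ξ g k s * u s| ≤ ‖u‖ * density ξ g k s := by
  rw [abs_mul, abs_of_nonneg (h.density_nonneg k s), mul_comm]
  exact mul_le_mul_of_nonneg_right (u.norm_coe_le_norm s) (h.density_nonneg k s)

theorem continuous_density_mul (h : IsFront ξ g) (k : ℕ) (u : ℝ →ᵇ ℝ) :
    Continuous fun s => density ξ g k s * u s :=
  (h.continuous_density k).mul u.continuous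

theorem integrableOn_density_mul (h : IsFront ξ g) (k : ℕ) (u : ℝ →ᵇ ℝ) (y : ℝ) :
    IntegrableOn (fun s => density ξ g k s * u s) (Ioi y) :=
  Integrable.mono' ((h.integrableOn_density k y).const_mul ‖u‖)
    (h.continuous_density_mul k u).aestronglyMeasurable
    (ae_of_all _ fun s => h.abs_density_mul_le k u s)

theorem abs_expTail_density_le (h : IsFront ξ g) (k : ℕ) {a : ℝ} (ha : 0 ≤ a) (u : ℝ →ᵇ ℝ)
    (y : ℝ) : |expTail a (fun s => density ξ g k s * u s) y| ≤
      ‖u‖ * (((ξ y)⁻¹ ^ (k + 1) - 1) / (k + 1)) := by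
  rw [← h.integral_density]
  exact abs_expTail_le ha (h.integrableOn_density k y) (h.abs_density_mul_le k u)

theorem tendsto_expTail_density (h : IsFront ξ g) (k : ℕ) {a : ℝ} (ha : 0 ≤ a) (u : ℝ →ᵇ ℝ) :
    Tendsto (expTail a (fun s => density ξ g k s * u s)) atTop (𝓝 0) := by
  refine squeeze_zero_norm (fun y => h.abs_expTail_density_le k ha u y) ?_
  have := ((((h.tendsto.inv₀ one_ne_zero).pow (k + 1)).sub_const 1).div_const
    (k + 1 : ℝ)).const_mul ‖u‖
  simpa using this

/-- The linear part of the Volterra operator. -/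
noncomputable def volterra (ξ g : ℝ → ℝ) (k : ℕ) (p q a : ℝ) (u : ℝ → ℝ) (y : ℝ) : ℝ :=
  ξ y ^ (k + 1) * ((p * expTail 0 (fun s => density ξ g k s * u s) y +
    q * expTail a (fun s => density ξ g k s * u s) y) / 2)

theorem abs_volterra_le (h : IsFront ξ g) {k : ℕ} {p q a : ℝ} (ha : 0 ≤ a)
    (hk : |p| + |q| ≤ k + 1) (u : ℝ →ᵇ ℝ) (y : ℝ) :
    |volterra ξ g k p q a u y| ≤ 1 / 2 * ‖u‖ := by
  have hp := pow_pos (h.pos y) (k + 1)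
  have hk0 : (0 : ℝ) < k + 1 := by positivity
  set X := ((ξ y)⁻¹ ^ (k + 1)) / (k + 1 : ℝ) with hX
  have hX0 : 0 ≤ X := div_nonneg (pow_nonneg (inv_nonneg.2 (h.pos y).le) _) hk0.le
  have key : ∀ b : ℝ, 0 ≤ b →
      |expTail b (fun s => density ξ g k s * u s) y| ≤ ‖u‖ * X := fun b hb =>
    (h.abs_expTail_density_le k hb u y).trans (by rw [hX]; gcongr; linarith)
  have h1 := key 0 le_rfl
  have h2 := key a ha
  rw [volterra, abs_mul, abs_of_pos hp, abs_div, abs_two]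
  have h3 : ξ y ^ (k + 1) * ((k + 1) * X) = 1 := by
    rw [hX, mul_div_cancel₀ _ hk0.ne', ← mul_pow, mul_inv_cancel₀ (h.pos y).ne', one_pow]
  calc _ ≤ ξ y ^ (k + 1) * ((|p| * (‖u‖ * X) + |q| * (‖u‖ * X)) / 2) := by
        gcongr
        refine (abs_add_le _ _).trans ?_
        rw [abs_mul, abs_mul]
        gcongr
    _ = ξ y ^ (k + 1) * (((|p| + |q|) * X) / 2 * ‖u‖) := by ring
    _ ≤ ξ y ^ (k + 1) * (((k + 1) * X) / 2 * ‖u‖) := by gcongr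
    _ = _ := by linear_combination (‖u‖ / 2) * h3

theorem continuous_volterra (h : IsFront ξ g) (k : ℕ) (p q : ℝ) {a : ℝ} (ha : 0 ≤ a)
    (u : ℝ →ᵇ ℝ) : Continuous (volterra ξ g k p q a u) := by
  have key : ∀ b : ℝ, 0 ≤ b → Continuous (expTail b (fun s => density ξ g k s * u s)) :=
    fun b hb => continuous_iff_continuousAt.2 fun y =>
      (hasDerivAt_expTail hb (h.continuous_density_mul k u)
        (h.integrableOn_density_mul k u) y).continuousAt
  exact (h.continuous.pow _).mul
    ((((key 0 le_rfl).const_mul p).add ((key a ha).const_mul q)).div_const 2)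

theorem volterra_sub (h : IsFront ξ g) (k : ℕ) (p q : ℝ) {a : ℝ} (ha : 0 ≤ a)
    (u v : ℝ →ᵇ ℝ) (y : ℝ) : volterra ξ g k p q a (u - v : ℝ →ᵇ ℝ) y =
      volterra ξ g k p q a u y - volterra ξ g k p q a v y := by
  have key : ∀ b : ℝ, 0 ≤ b → expTail b (fun s => density ξ g k s * (u - v : ℝ →ᵇ ℝ) s) y =
      expTail b (fun s => density ξ g k s * u s) y -
        expTail b (fun s => density ξ g k s * v s) y := fun b hb => by
    rw [← expTail_sub hb (h.continuous_density_mul k u) (h.continuous_density_mul k v)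
      (h.integrableOn_density_mul k u y) (h.integrableOn_density_mul k v y)]
    simp only [BoundedContinuousFunction.coe_sub, Pi.sub_apply, mul_sub]
  rw [volterra, key 0 le_rfl, key a ha, volterra, volterra]
  ring

theorem exists_volterra_fixedPoint (h : IsFront ξ g) {k : ℕ} {p q a : ℝ} (ha : 0 ≤ a)
    (hk : |p| + |q| ≤ k + 1) :
    ∃ u : ℝ →ᵇ ℝ, ∀ y, u y = ξ y ^ (k + 1) - volterra ξ g k p q a u y := by
  let T : (ℝ →ᵇ ℝ) → (ℝ →ᵇ ℝ) := fun u => ofNormedAddCommGroup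
    (fun y => ξ y ^ (k + 1) - volterra ξ g k p q a u y)
    ((h.continuous.pow _).sub (h.continuous_volterra k p q ha u)) (1 + 1 / 2 * ‖u‖) fun y => by
      refine (norm_sub_le _ _).trans (add_le_add ?_ (h.abs_volterra_le ha hk u y))
      rw [norm_pow, Real.norm_of_nonneg (h.pos y).le]
      exact pow_le_one₀ (h.pos y).le (h.lt_one y).le
  have hT : ContractingWith (1 / 2) T := by
    refine ⟨by rw [← NNReal.coe_lt_coe]; norm_num, LipschitzWith.of_dist_le_mul fun u v => ?_⟩
    refine (BoundedContinuousFunction.dist_le (by positivity)).2 fun y => ?_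
    have h1 := h.abs_volterra_le ha hk (u - v) y
    rw [h.volterra_sub k p q ha] at h1
    rw [Real.dist_eq, dist_eq_norm u v, abs_sub_comm]
    simp only [T, coe_ofNormedAddCommGroup]
    rw [sub_sub_sub_cancel_left]
    simpa using h1
  refine ⟨hT.fixedPoint, fun y => ?_⟩
  exact (DFunLike.congr_fun hT.fixedPoint_isFixedPt y).symm

/-- A solution of the system in the unknowns `U` and `Z = (1 - lam) ξ U + V`. -/
theorem exists_solution (h : IsFront ξ g) {ε : ℝ} (hε : 0 ≤ ε) (lam : ℝ) :
    ∃ U Z : ℝ → ℝ, (∀ y, HasDerivAt U (ε / ξ y * Z y) y) ∧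
      (∀ y, HasDerivAt Z (2 * ε * Z y + (1 - lam) * g y * U y) y) ∧
      Tendsto U atTop (𝓝 1) ∧ Tendsto Z atTop (𝓝 0) := by
  obtain ⟨k, hk⟩ := exists_nat_ge (|1 + lam| + |1 - lam|)
  have hε2 : 0 ≤ 2 * ε := by positivity
  obtain ⟨u, hu⟩ := h.exists_volterra_fixedPoint (p := 1 + lam) (q := 1 - lam) hε2
    (hk.trans (by linarith))
  set A := expTail 0 fun s => density ξ g k s * u s with hA
  set B := expTail (2 * ε) fun s => density ξ g k s * u s with hB
  have dA : ∀ y, HasDerivAt A (0 * A y - density ξ g k y * u y) y :=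
    hasDerivAt_expTail le_rfl (h.continuous_density_mul k u) (h.integrableOn_density_mul k u)
  have dB : ∀ y, HasDerivAt B (2 * ε * B y - density ξ g k y * u y) y :=
    hasDerivAt_expTail hε2 (h.continuous_density_mul k u) (h.integrableOn_density_mul k u)
  have lA : Tendsto A atTop (𝓝 0) := h.tendsto_expTail_density k le_rfl u
  have lB : Tendsto B atTop (𝓝 0) := h.tendsto_expTail_density k hε2 u
  let U : ℝ → ℝ := fun y => (2 - (1 + lam) * A y - (1 - lam) * B y) / (2 * ξ y)
  have hU : ∀ y, density ξ g k y * u y = g y * U y := fun y => by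
    have hp := (h.pos y).ne'
    rw [hu y, density, volterra, ← hA, ← hB, inv_pow]
    simp only [U]
    field_simp
    ring
  refine ⟨U, fun y => -(1 - lam) * B y, fun y => ?_, fun y => ?_, ?_, ?_⟩
  · have hp := (h.pos y).ne'
    have d := ((((dA y).const_mul (1 + lam)).const_sub 2).sub ((dB y).const_mul (1 - lam))).div
      ((h.hasDerivAt y).const_mul 2) (mul_ne_zero two_ne_zero hp)
    refine d.congr_deriv ?_
    rw [hU]
    simp only [U, Pi.sub_apply]
    field_simp
    ring
  · refine ((dB y).const_mul (-(1 - lam))).congr_deriv ?_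
    rw [hU]
    ring
  · have : Tendsto U atTop (𝓝 ((2 - (1 + lam) * 0 - (1 - lam) * 0) / (2 * 1))) :=
      (((lA.const_mul (1 + lam)).const_sub 2).sub (lB.const_mul (1 - lam))).div
      (h.tendsto.const_mul 2) (by norm_num)
    simpa using this
  · simpa using lB.const_mul (-(1 - lam))

theorem eq_zero_of_tendsto_zero (h : IsFront ξ g) {ε lam : ℝ} (hε : 0 ≤ ε) {U Z : ℝ → ℝ}
    (dU : ∀ y, HasDerivAt U (ε / ξ y * Z y) y)
    (dZ : ∀ y, HasDerivAt Z (2 * ε * Z y + (1 - lam) * g y * U y) y)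
    (lU : Tendsto U atTop (𝓝 0)) (lZ : Tendsto Z atTop (𝓝 0)) (y : ℝ) : U y = 0 ∧ Z y = 0 := by
  obtain ⟨k, hk⟩ := exists_nat_ge (2 * |1 + lam| + 2 * |1 - lam|)
  let P : ℝ → ℝ := fun y => 2 * ξ y * U y - Z y
  have dP : ∀ y, HasDerivAt P ((1 + lam) * g y * U y) y := fun y => by
    have hp := (h.pos y).ne'
    refine ((((h.hasDerivAt y).const_mul 2).mul (dU y)).sub (dZ y)).congr_deriv ?_
    field_simp
    ring
  have lP : Tendsto P atTop (𝓝 0) := by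
    simpa using ((h.tendsto.const_mul 2).mul lU).sub lZ
  let E : ℝ → ℝ := fun y => (P y ^ 2 + Z y ^ 2) * ξ y ^ (k + 1)
  have dE : ∀ y, HasDerivAt E ((2 * P y * ((1 + lam) * g y * U y) +
      2 * Z y * (2 * ε * Z y + (1 - lam) * g y * U y)) * ξ y ^ (k + 1) +
      (P y ^ 2 + Z y ^ 2) * ((k + 1) * ξ y ^ k * g y)) y := fun y => by
    refine ((((dP y).pow 2).add ((dZ y).pow 2)).mul ((h.hasDerivAt y).pow (k + 1))).congr_deriv ?_
    simp
  have mono : Monotone E := by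
    refine monotone_of_hasDerivAt_nonneg dE fun y => ?_
    have hp := h.pos y
    have hg := h.nonneg y
    have hPU : P y + Z y = 2 * (ξ y * U y) := by simp only [P]; ring
    have b1 : -(|1 + lam| * (2 * (P y ^ 2 + Z y ^ 2))) ≤ (1 + lam) * (P y * (P y + Z y)) := by
      have : |P y * (P y + Z y)| ≤ 2 * (P y ^ 2 + Z y ^ 2) := by
        rw [abs_le]; constructor <;> nlinarith [sq_nonneg (P y + Z y), sq_nonneg (P y - Z y)]
      refine (abs_le.1 ?_).1
      rw [abs_mul]
      gcongr
    have b2 : -(|1 - lam| * (2 * (P y ^ 2 + Z y ^ 2))) ≤ (1 - lam) * (Z y * (P y + Z y)) := by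
      have : |Z y * (P y + Z y)| ≤ 2 * (P y ^ 2 + Z y ^ 2) := by
        rw [abs_le]; constructor <;> nlinarith [sq_nonneg (P y + Z y), sq_nonneg (P y - Z y)]
      refine (abs_le.1 ?_).1
      rw [abs_mul]
      gcongr
    have b3 : (2 * |1 + lam| + 2 * |1 - lam|) * (P y ^ 2 + Z y ^ 2) ≤
        k * (P y ^ 2 + Z y ^ 2) := by gcongr
    have b4 : 0 ≤ (1 + lam) * (P y * (P y + Z y)) + (1 - lam) * (Z y * (P y + Z y)) +
        (k + 1) * (P y ^ 2 + Z y ^ 2) := by nlinarith [sq_nonneg (P y), sq_nonneg (Z y)]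
    have b5 := mul_nonneg (mul_nonneg hg (pow_pos hp k).le) b4
    have b6 : 0 ≤ 4 * ε * Z y ^ 2 * ξ y ^ (k + 1) := by positivity
    rw [hPU] at b5
    refine (add_nonneg b5 b6).trans_eq ?_
    ring
  have lE : Tendsto E atTop (𝓝 0) := by
    simpa using ((lP.pow 2).add (lZ.pow 2)).mul (h.tendsto.pow (k + 1))
  have hE : E y ≤ 0 := mono.ge_of_tendsto lE y
  have hp := h.pos y
  have hs : P y ^ 2 + Z y ^ 2 ≤ 0 := nonpos_of_mul_nonpos_left hE (pow_pos hp _)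
  have hZ : Z y = 0 := by nlinarith [sq_nonneg (P y), sq_nonneg (Z y)]
  have hP : P y = 0 := by nlinarith [sq_nonneg (P y), sq_nonneg (Z y)]
  refine ⟨?_, hZ⟩
  simp only [P, hZ, sub_zero] at hP
  simpa [hp.ne'] using hP

end IsFront

theorem isFront_of_kull_anisimov {ν : ℝ} (hν : 0 ≤ ν + 1) {ξ : ℝ → ℝ} (hξdiff : Differentiable ℝ ξ)
    (hξpos : ∀ y, 0 < ξ y) (hξlt : ∀ y, ξ y < 1)
    (hode : ∀ y, deriv ξ y = ξ y ^ (ν + 1) * (1 - ξ y)) : IsFront ξ (deriv ξ) := by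
  have hd : ∀ y, HasDerivAt ξ (deriv ξ y) y := fun y => (hξdiff y).hasDerivAt
  have hnn : ∀ y, 0 ≤ deriv ξ y := fun y => by
    rw [hode]
    exact mul_nonneg (Real.rpow_nonneg (hξpos y).le _) (by linarith [hξlt y])
  refine ⟨hd, ?_, hnn, hξpos, hξlt, ?_⟩
  · rw [funext hode]
    exact (hξdiff.continuous.rpow_const fun y => Or.inl (hξpos y).ne').mul
      (continuous_const.sub hξdiff.continuous)
  · have hmono : Monotone ξ := monotone_of_deriv_nonneg hξdiff hnn
    set a := ξ 0 ^ (ν + 1) with ha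
    have ha0 : 0 < a := Real.rpow_pos_of_pos (hξpos 0) _
    have dF : ∀ y, HasDerivAt (fun y => (1 - ξ y) * Real.exp (a * y))
        (-(deriv ξ y) * Real.exp (a * y) + (1 - ξ y) * (Real.exp (a * y) * (a * 1))) y := fun y =>
      ((hd y).const_sub 1).mul ((hasDerivAt_id y).const_mul a).exp
    have hanti : AntitoneOn (fun y => (1 - ξ y) * Real.exp (a * y)) (Ici 0) := by
      refine antitoneOn_of_deriv_nonpos (convex_Ici 0)
        (fun y _ => (dF y).continuousAt.continuousWithinAt)
        (fun y _ => (dF y).differentiableAt.differentiableWithinAt) fun y hy => ?_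
      rw [interior_Ici] at hy
      rw [(dF y).deriv, hode]
      have h1 : a ≤ ξ y ^ (ν + 1) :=
        Real.rpow_le_rpow (hξpos 0).le (hmono (le_of_lt hy)) hν
      have h2 : 0 ≤ (1 - ξ y) * Real.exp (a * y) :=
        mul_nonneg (by linarith [hξlt y]) (Real.exp_pos _).le
      nlinarith [mul_nonneg (sub_nonneg.2 h1) h2]
    have hbound : ∀ y, 0 ≤ y → 1 - Real.exp (-(a * y)) ≤ ξ y := fun y hy => by
      have h1 : (1 - ξ y) * Real.exp (a * y) ≤ 1 := by
        refine (hanti self_mem_Ici hy hy).trans ?_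
        simpa using (hξpos 0).le
      rw [Real.exp_neg, sub_le_comm, ← one_div, le_div_iff₀ (Real.exp_pos _)]
      exact h1
    refine tendsto_of_tendsto_of_tendsto_of_le_of_le' (g := fun y => 1 - Real.exp (-(a * y))) ?_
      tendsto_const_nhds ((eventually_ge_atTop 0).mono hbound)
      (Eventually.of_forall fun y => (hξlt y).le)
    have : Tendsto (fun y => Real.exp (-(a * y))) atTop (𝓝 0) :=
      Real.tendsto_exp_neg_atTop_nhds_zero.comp (tendsto_id.const_mul_atTop ha0)
    simpa using this.const_sub 1

/-- For a Kull–Anisimov profile `ξ`, `ε > 0` and `λ ∈ ℝ`, there is a unique `C¹`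
solution `(U, V)` of the system
`U' = ε(1-λ)U + (ε/ξ)V`, `V' = ε(λ+1)V + ε(1-λ²)ξU`
with `(U, V) → (1, λ-1)` at `+∞`. -/
theorem stmt_11 (ν : ℝ) (hν : 1 < ν) (ξ : ℝ → ℝ)
    (hξdiff : Differentiable ℝ ξ)
    (hξpos : ∀ y, 0 < ξ y) (hξlt : ∀ y, ξ y < 1)
    (hode : ∀ y, deriv ξ y = ξ y ^ (ν + 1) * (1 - ξ y))
    (ε lam : ℝ) (hε : 0 < ε) :
    ∃! UV : (ℝ → ℝ) × (ℝ → ℝ),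
      ContDiff ℝ 1 UV.1 ∧ ContDiff ℝ 1 UV.2 ∧
      (∀ y, deriv UV.1 y = ε * (1 - lam) * UV.1 y + ε / ξ y * UV.2 y) ∧
      (∀ y, deriv UV.2 y = ε * (lam + 1) * UV.2 y + ε * (1 - lam ^ 2) * ξ y * UV.1 y) ∧
      Tendsto (fun y => (UV.1 y, UV.2 y)) atTop (nhds ((1 : ℝ), lam - 1)) := by
  have h := isFront_of_kull_anisimov (by linarith) hξdiff hξpos hξlt hode
  have hne : ∀ y, ξ y ≠ 0 := fun y => (hξpos y).ne'
  obtain ⟨U, Z, dU, dZ, lU, lZ⟩ := h.exists_solution hε.le lam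
  have cU : Continuous U := continuous_iff_continuousAt.2 fun y => (dU y).continuousAt
  have cZ : Continuous Z := continuous_iff_continuousAt.2 fun y => (dZ y).continuousAt
  have cξ := h.continuous
  let V : ℝ → ℝ := fun y => Z y - (1 - lam) * (ξ y * U y)
  have cV : Continuous V := by fun_prop
  have dU' : ∀ y, HasDerivAt U (ε * (1 - lam) * U y + ε / ξ y * V y) y := fun y => by
    refine (dU y).congr_deriv ?_
    have := hne y
    simp only [V]
    field_simp
    ring
  have dV : ∀ y, HasDerivAt V (ε * (lam + 1) * V y + ε * (1 - lam ^ 2) * ξ y * U y) y := fun y => by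
    refine ((dZ y).sub (((h.hasDerivAt y).mul (dU y)).const_mul (1 - lam))).congr_deriv ?_
    have := hne y
    simp only [V]
    field_simp
    ring
  refine ⟨(U, V), ⟨?_, ?_, fun y => (dU' y).deriv, fun y => (dV y).deriv, ?_⟩, ?_⟩
  · refine contDiff_one_iff_deriv.2 ⟨fun y => (dU' y).differentiableAt, ?_⟩
    rw [funext fun y => (dU' y).deriv]
    exact (cU.const_mul _).add ((continuous_const.div cξ hne).mul cV)
  · refine contDiff_one_iff_deriv.2 ⟨fun y => (dV y).differentiableAt, ?_⟩
    rw [funext fun y => (dV y).deriv]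
    fun_prop
  · refine lU.prodMk_nhds ?_
    have := lZ.sub ((h.tendsto.mul lU).const_mul (1 - lam))
    simpa using this
  · rintro ⟨U₂, V₂⟩ ⟨cU₂, cV₂, eU₂, eV₂, l₂⟩
    simp only at cU₂ cV₂ eU₂ eV₂ l₂
    have lU₂ : Tendsto U₂ atTop (𝓝 1) := l₂.fst_nhds
    have lV₂ : Tendsto V₂ atTop (𝓝 (lam - 1)) := l₂.snd_nhds
    have dU₂ : ∀ y, HasDerivAt U₂ (deriv U₂ y) y := fun y =>
      (cU₂.differentiable one_ne_zero y).hasDerivAt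
    have dV₂ : ∀ y, HasDerivAt V₂ (deriv V₂ y) y := fun y =>
      (cV₂.differentiable one_ne_zero y).hasDerivAt
    let Z₂ : ℝ → ℝ := fun y => (1 - lam) * (ξ y * U₂ y) + V₂ y
    have key := h.eq_zero_of_tendsto_zero (lam := lam) hε.le (U := fun y => U₂ y - U y)
      (Z := fun y => Z₂ y - Z y)
      (fun y => by
        refine ((dU₂ y).sub (dU y)).congr_deriv ?_
        have := hne y
        rw [eU₂]
        simp only [Z₂]
        field_simp)
      (fun y => by
        refine (((((h.hasDerivAt y).mul (dU₂ y)).const_mul (1 - lam)).add (dV₂ y)).sub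
          (dZ y)).congr_deriv ?_
        have := hne y
        rw [eU₂, eV₂]
        simp only [Z₂]
        field_simp
        ring)
      (by simpa using lU₂.sub lU)
      (by simpa using (((h.tendsto.mul lU₂).const_mul (1 - lam)).add lV₂).sub lZ)
    have hU : U₂ = U := funext fun y => sub_eq_zero.1 (key y).1
    refine Prod.ext hU (funext fun y => ?_)
    have hZ := sub_eq_zero.1 (key y).2
    simp only [Z₂, hU] at hZ
    simp only [V]
    linarith
end

section
/- Let ν > 1 and λ ∈ [1/2, 3/2]. Set a = −(1 + λ)/(2ν) and b = −1/ν. Then there exists a unique C² function W : (0, ∞) → ℝ solving the confluent hypergeometric (Kummer) equation T·W''(T) − (1/ν + T)·W'(T) + ((1 + λ)/(2ν))·W(T) = 0 for all T > 0 and satisfying lim_{T→+∞} T^(−(1+λ)/(2ν))·W(T) = 1; moreover W extends continuously to T = 0 with lim_{T→0⁺} W(T) = Γ(1 + 1/ν)/Γ(1 + (1 − λ)/(2ν)), where Γ is the Euler Gamma function. -/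
open Filter Topology Set

/-- The integral `∫₀^∞ e^(-s) s^(α-1) (T+s)^p ds`, which up to normalization is Tricomi's
confluent hypergeometric function. -/
noncomputable def kummerIntegral (α p T : ℝ) : ℝ :=
  ∫ s in Ioi (0 : ℝ), Real.exp (-s) * s ^ (α - 1) * (T + s) ^ p

theorem integrableOn_kummer {α T : ℝ} (hα : 0 < α) (hT : 0 < T) (p : ℝ) :
    MeasureTheory.IntegrableOn
      (fun s : ℝ => Real.exp (-s) * s ^ (α - 1) * (T + s) ^ p) (Ioi 0) := by
  have hm : MeasureTheory.AEStronglyMeasurable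
      (fun s : ℝ => Real.exp (-s) * s ^ (α - 1) * (T + s) ^ p)
      (MeasureTheory.volume.restrict (Ioi 0)) := by
    apply Measurable.aestronglyMeasurable
    fun_prop
  have h1 := Real.GammaIntegral_convergent hα
  rcases le_total p 0 with hp | hp
  · refine MeasureTheory.Integrable.mono' (h1.mul_const (T ^ p)) hm ?_
    filter_upwards [MeasureTheory.ae_restrict_mem measurableSet_Ioi] with s hs
    have hs : 0 < s := hs
    rw [Real.norm_of_nonneg (by positivity)]
    exact mul_le_mul_of_nonneg_left
      (Real.rpow_le_rpow_of_nonpos hT (by linarith) hp) (by positivity)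
  · have h2 := Real.GammaIntegral_convergent (s := α + p) (by linarith)
    refine MeasureTheory.Integrable.mono'
      ((h1.mul_const ((2 * T) ^ p)).add (h2.mul_const ((2 : ℝ) ^ p))) hm ?_
    filter_upwards [MeasureTheory.ae_restrict_mem measurableSet_Ioi] with s hs
    have hs : 0 < s := hs
    rw [Real.norm_of_nonneg (by positivity)]
    have key : (T + s) ^ p ≤ (2 * T) ^ p + (2 * s) ^ p := by
      rcases le_total T s with h | h
      · have := Real.rpow_le_rpow (by positivity) (by linarith : T + s ≤ 2 * s) hp
        have : 0 ≤ (2 * T) ^ p := by positivity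
        linarith
      · have := Real.rpow_le_rpow (by positivity) (by linarith : T + s ≤ 2 * T) hp
        have : 0 ≤ (2 * s) ^ p := by positivity
        linarith
    have e : s ^ (α + p - 1) = s ^ (α - 1) * s ^ p := by
      rw [← Real.rpow_add hs]; ring_nf
    simp only [Pi.add_apply]
    rw [e]
    calc _ ≤ Real.exp (-s) * s ^ (α - 1) * ((2 * T) ^ p + (2 * s) ^ p) :=
          mul_le_mul_of_nonneg_left key (by positivity)
      _ = _ := by rw [Real.mul_rpow (x := 2) (y := s) (by norm_num) hs.le]; ring

theorem hasDerivAt_kummerIntegral {α T : ℝ} (hα : 0 < α) (hT : 0 < T) (p : ℝ) :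
    HasDerivAt (kummerIntegral α p) (p * kummerIntegral α (p - 1) T) T := by
  have hb : ∀ x ∈ Metric.ball T (T / 2), T / 2 < x ∧ x < 2 * T := by
    intro x hx
    rw [Metric.mem_ball, Real.dist_eq, abs_lt] at hx
    constructor <;> linarith
  have := (hasDerivAt_integral_of_dominated_loc_of_deriv_le
    (μ := MeasureTheory.volume.restrict (Ioi (0 : ℝ)))
    (F := fun x s : ℝ => Real.exp (-s) * s ^ (α - 1) * (x + s) ^ p)
    (F' := fun x s : ℝ => p * (Real.exp (-s) * s ^ (α - 1) * (x + s) ^ (p - 1)))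
    (bound := fun s : ℝ => |p| * (Real.exp (-s) * s ^ (α - 1) * (T / 2 + s) ^ (p - 1) +
      Real.exp (-s) * s ^ (α - 1) * (2 * T + s) ^ (p - 1)))
    (x₀ := T) (s := Metric.ball T (T / 2)) (Metric.ball_mem_nhds T (by positivity)) ?_
    (integrableOn_kummer hα hT p) ?_ ?_ ?_ ?_).2
  · rw [MeasureTheory.integral_const_mul] at this
    exact this
  · refine Eventually.of_forall fun x => Measurable.aestronglyMeasurable ?_
    fun_prop
  · apply Measurable.aestronglyMeasurable
    fun_prop
  · filter_upwards [MeasureTheory.ae_restrict_mem measurableSet_Ioi] with s hs x hx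
    have hs : 0 < s := hs
    obtain ⟨h1, h2⟩ := hb x hx
    have hx0 : 0 < x := by linarith
    rw [norm_mul, Real.norm_eq_abs, Real.norm_of_nonneg (by positivity), ← mul_add]
    refine mul_le_mul_of_nonneg_left (mul_le_mul_of_nonneg_left ?_ (by positivity))
      (abs_nonneg p)
    rcases le_total (p - 1) 0 with hp | hp
    · have := Real.rpow_le_rpow_of_nonpos (by positivity)
        (by linarith : T / 2 + s ≤ x + s) hp
      have : 0 ≤ (2 * T + s) ^ (p - 1) := by positivity
      linarith
    · have := Real.rpow_le_rpow (by positivity) (by linarith : x + s ≤ 2 * T + s) hp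
      have : 0 ≤ (T / 2 + s) ^ (p - 1) := by positivity
      linarith
  · exact ((integrableOn_kummer hα (by positivity) _).add
      (integrableOn_kummer hα (by positivity) _)).const_mul _
  · filter_upwards [MeasureTheory.ae_restrict_mem measurableSet_Ioi] with s hs x hx
    have hs : 0 < s := hs
    have hx0 : 0 < x := by linarith [(hb x hx).1]
    have h := (((hasDerivAt_id x).add_const s).rpow_const (p := p)
      (Or.inl (by simp only [id]; positivity))).const_mul (Real.exp (-s) * s ^ (α - 1))
    refine h.congr_deriv ?_
    simp only [id]; ring

theorem contDiffOn_kummerIntegral {α : ℝ} (hα : 0 < α) (n : ℕ) (p : ℝ) :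
    ContDiffOn ℝ n (kummerIntegral α p) (Ioi 0) := by
  induction n generalizing p with
  | zero =>
    rw [Nat.cast_zero, contDiffOn_zero]
    exact fun T hT => (hasDerivAt_kummerIntegral hα hT p).continuousAt.continuousWithinAt
  | succ n ih =>
    rw [Nat.cast_succ, contDiffOn_succ_iff_deriv_of_isOpen isOpen_Ioi]
    refine ⟨fun T hT => (hasDerivAt_kummerIntegral hα hT p).differentiableAt.differentiableWithinAt,
      by simp, ?_⟩
    exact (contDiffOn_const.mul (ih (p - 1))).congr
      fun T hT => (hasDerivAt_kummerIntegral hα hT p).deriv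

theorem kummerIntegral_pos {α T : ℝ} (hα : 0 < α) (hT : 0 < T) (p : ℝ) :
    0 < kummerIntegral α p T := by
  have hpos : ∀ s ∈ Ioi (0 : ℝ), 0 < Real.exp (-s) * s ^ (α - 1) * (T + s) ^ p := by
    intro s hs
    have hs : 0 < s := hs
    positivity
  unfold kummerIntegral
  rw [MeasureTheory.setIntegral_pos_iff_support_of_nonneg_ae _ (integrableOn_kummer hα hT p)]
  · have : Ioi (0 : ℝ) ⊆ (Function.support fun s : ℝ =>
        Real.exp (-s) * s ^ (α - 1) * (T + s) ^ p) ∩ Ioi 0 :=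
      fun s hs => ⟨(hpos s hs).ne', hs⟩
    exact lt_of_lt_of_le (by simp) (MeasureTheory.measure_mono this)
  · filter_upwards [MeasureTheory.ae_restrict_mem measurableSet_Ioi] with s hs
    exact (hpos s hs).le

theorem kummerIntegral_add_one {α T : ℝ} (hα : 0 < α) (hT : 0 < T) (p : ℝ) :
    kummerIntegral (α + 1) p T = kummerIntegral α (p + 1) T - T * kummerIntegral α p T := by
  unfold kummerIntegral
  rw [← MeasureTheory.integral_const_mul, ← MeasureTheory.integral_sub
    (integrableOn_kummer hα hT _) ((integrableOn_kummer hα hT _).const_mul _)]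
  refine MeasureTheory.setIntegral_congr_fun measurableSet_Ioi fun s hs => ?_
  have hs : 0 < s := hs
  have e : s ^ (α + 1 - 1) = s ^ (α - 1) * s := by
    rw [← Real.rpow_add_one hs.ne']; ring_nf
  simp only [e, Real.rpow_add_one (by positivity : T + s ≠ 0)]
  ring

theorem kummerIntegral_recurrence {α T : ℝ} (hα : 0 < α) (hT : 0 < T) (p : ℝ) :
    α * kummerIntegral α p T + p * kummerIntegral (α + 1) (p - 1) T
      - kummerIntegral (α + 1) p T = 0 := by
  set f : ℝ → ℝ := fun s => Real.exp (-s) * s ^ α * (T + s) ^ p with hf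
  set f' : ℝ → ℝ := fun s => α * (Real.exp (-s) * s ^ (α - 1) * (T + s) ^ p) +
    p * (Real.exp (-s) * s ^ (α + 1 - 1) * (T + s) ^ (p - 1)) -
    Real.exp (-s) * s ^ (α + 1 - 1) * (T + s) ^ p with hf'
  have i1 := (integrableOn_kummer hα hT p).const_mul α
  have i2 := (integrableOn_kummer (by linarith : 0 < α + 1) hT (p - 1)).const_mul p
  have i3 := integrableOn_kummer (by linarith : 0 < α + 1) hT p
  have hd : ∀ s ∈ Ioi (0 : ℝ), HasDerivAt f (f' s) s := by
    intro s hs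
    have hs : 0 < s := hs
    have h := (((hasDerivAt_neg s).exp.mul (Real.hasDerivAt_rpow_const (p := α)
      (Or.inl hs.ne'))).mul (((hasDerivAt_id s).const_add T).rpow_const (p := p)
      (Or.inl (by simp only [id]; positivity))))
    refine h.congr_deriv ?_
    simp only [hf', add_sub_cancel_right, id, Pi.mul_apply]
    ring
  have hi' : MeasureTheory.IntegrableOn f' (Ioi 0) := (i1.add i2).sub i3
  have hi : MeasureTheory.IntegrableOn f (Ioi 0) := by
    simpa only [add_sub_cancel_right] using i3
  have hc : ContinuousWithinAt f (Ici 0) 0 := by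
    apply ContinuousAt.continuousWithinAt
    refine ContinuousAt.mul (ContinuousAt.mul (by fun_prop)
      (Real.continuousAt_rpow_const _ _ (Or.inr hα.le))) ?_
    exact ContinuousAt.rpow_const (by fun_prop) (Or.inl (by simpa using hT.ne'))
  have h := MeasureTheory.integral_Ioi_of_hasDerivAt_of_tendsto hc hd hi'
    (MeasureTheory.tendsto_zero_of_hasDerivAt_of_integrableOn_Ioi hd hi' hi)
  have h0 : f 0 = 0 := by simp [hf, Real.zero_rpow hα.ne']
  rw [h0, sub_zero] at h
  have e : ∫ s in Ioi (0 : ℝ), f' s = α * kummerIntegral α p T +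
      p * kummerIntegral (α + 1) (p - 1) T - kummerIntegral (α + 1) p T := by
    unfold kummerIntegral
    rw [← MeasureTheory.integral_const_mul, ← MeasureTheory.integral_const_mul,
      ← MeasureTheory.integral_add i1 i2]
    exact MeasureTheory.integral_sub (i1.add i2) i3
  rw [← e, h]

theorem kummerIntegral_ode {α T : ℝ} (hα : 0 < α) (hT : 0 < T) (p : ℝ) :
    T * deriv (deriv (kummerIntegral α p)) T - (α + p - 1 + T) * deriv (kummerIntegral α p) T
      + p * kummerIntegral α p T = 0 := by
  have d2 : deriv (deriv (kummerIntegral α p)) T =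
      p * ((p - 1) * kummerIntegral α (p - 1 - 1) T) := by
    have he : deriv (kummerIntegral α p) =ᶠ[𝓝 T] fun x => p * kummerIntegral α (p - 1) x := by
      filter_upwards [Ioi_mem_nhds hT] with x hx
      exact (hasDerivAt_kummerIntegral hα hx p).deriv
    rw [he.deriv_eq]
    exact ((hasDerivAt_kummerIntegral hα hT (p - 1)).const_mul p).deriv
  rw [d2, (hasDerivAt_kummerIntegral hα hT p).deriv]
  have h := kummerIntegral_recurrence hα hT (p - 1)
  rw [kummerIntegral_add_one hα hT, kummerIntegral_add_one hα hT, sub_add_cancel,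
    sub_add_cancel] at h
  linear_combination (-p) * h

theorem tendsto_kummerIntegral_zero {α p : ℝ} (hα : 0 < α) (hp : 0 < p) :
    Tendsto (kummerIntegral α p) (𝓝[>] 0) (𝓝 (Real.Gamma (α + p))) := by
  rw [Real.Gamma_eq_integral (by positivity)]
  have e : ∫ s in Ioi (0 : ℝ), Real.exp (-s) * s ^ (α + p - 1) =
      ∫ s in Ioi (0 : ℝ), Real.exp (-s) * s ^ (α - 1) * (0 + s) ^ p := by
    refine MeasureTheory.setIntegral_congr_fun measurableSet_Ioi fun s hs => ?_
    have hs : 0 < s := hs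
    simp only [zero_add, mul_assoc, ← Real.rpow_add hs]
    ring_nf
  rw [e]
  refine MeasureTheory.tendsto_integral_filter_of_dominated_convergence
    (fun s => Real.exp (-s) * s ^ (α - 1) * (1 + s) ^ p) ?_ ?_
    (integrableOn_kummer hα one_pos p) ?_
  · refine Eventually.of_forall fun x => Measurable.aestronglyMeasurable ?_
    fun_prop
  · filter_upwards [Ioo_mem_nhdsGT (zero_lt_one' ℝ)] with T hT
    filter_upwards [MeasureTheory.ae_restrict_mem measurableSet_Ioi] with s hs
    have hs : 0 < s := hs
    have hT0 := hT.1
    rw [Real.norm_of_nonneg (by positivity)]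
    exact mul_le_mul_of_nonneg_left
      (Real.rpow_le_rpow (by positivity) (by linarith [hT.2]) hp.le) (by positivity)
  · filter_upwards [MeasureTheory.ae_restrict_mem measurableSet_Ioi] with s hs
    have hs : 0 < s := hs
    refine Tendsto.mono_left ?_ (nhdsWithin_le_nhds (s := Ioi 0))
    have : ContinuousAt (fun T : ℝ => Real.exp (-s) * s ^ (α - 1) * (T + s) ^ p) 0 :=
      continuousAt_const.mul (ContinuousAt.rpow_const (by fun_prop) (Or.inr hp.le))
    exact this

theorem tendsto_kummerIntegral_atTop {α p : ℝ} (hα : 0 < α) (hp : 0 < p) :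
    Tendsto (fun T => T ^ (-p) * kummerIntegral α p T) atTop (𝓝 (Real.Gamma α)) := by
  rw [Real.Gamma_eq_integral hα]
  have e : (fun T : ℝ => ∫ s in Ioi (0 : ℝ), Real.exp (-s) * s ^ (α - 1) * (1 + s / T) ^ p)
      =ᶠ[atTop] fun T => T ^ (-p) * kummerIntegral α p T := by
    filter_upwards [eventually_gt_atTop 0] with T hT
    unfold kummerIntegral
    rw [← MeasureTheory.integral_const_mul]
    refine MeasureTheory.setIntegral_congr_fun measurableSet_Ioi fun s hs => ?_
    have hs : 0 < s := hs
    have : T + s = T * (1 + s / T) := by field_simp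
    simp only [this, Real.mul_rpow hT.le (by positivity : 0 ≤ 1 + s / T), Real.rpow_neg hT.le]
    have : T ^ p ≠ 0 := by positivity
    field_simp
  refine Tendsto.congr' e ?_
  refine MeasureTheory.tendsto_integral_filter_of_dominated_convergence
    (fun s => Real.exp (-s) * s ^ (α - 1) * (1 + s) ^ p) ?_ ?_
    (integrableOn_kummer hα one_pos p) ?_
  · refine Eventually.of_forall fun x => Measurable.aestronglyMeasurable ?_
    fun_prop
  · filter_upwards [eventually_ge_atTop 1] with T hT
    filter_upwards [MeasureTheory.ae_restrict_mem measurableSet_Ioi] with s hs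
    have hs : 0 < s := hs
    have hT0 : 0 < T := by linarith
    rw [Real.norm_of_nonneg (by positivity)]
    exact mul_le_mul_of_nonneg_left (Real.rpow_le_rpow (by positivity)
      (by linarith [div_le_self hs.le hT]) hp.le) (by positivity)
  · filter_upwards with s
    have h1 : Tendsto (fun T : ℝ => 1 + s / T) atTop (𝓝 (1 + 0)) :=
      tendsto_const_nhds.add (tendsto_const_nhds.div_atTop tendsto_id)
    have h2 := (h1.rpow_const (p := p) (Or.inr hp.le)).const_mul (Real.exp (-s) * s ^ (α - 1))
    simpa using h2

theorem ContDiffOn.hasDerivAt_deriv_of_Ioi {f : ℝ → ℝ} (hf : ContDiffOn ℝ 2 f (Ioi 0))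
    {T : ℝ} (hT : 0 < T) :
    HasDerivAt f (deriv f T) T ∧ HasDerivAt (deriv f) (deriv (deriv f) T) T := by
  have h : ContDiffOn ℝ (1 + 1) f (Ioi 0) := by norm_num; exact hf
  rw [contDiffOn_succ_iff_deriv_of_isOpen isOpen_Ioi] at h
  have hn : Ioi 0 ∈ 𝓝 T := Ioi_mem_nhds hT
  exact ⟨((h.1 T hT).differentiableAt hn).hasDerivAt,
    (((h.2.2.differentiableOn one_ne_zero) T hT).differentiableAt hn).hasDerivAt⟩

/-- On `(0, ∞)`, a function with vanishing derivative is constant. -/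
theorem eq_of_hasDerivAt_zero_Ioi {f : ℝ → ℝ} (hf : ∀ T, 0 < T → HasDerivAt f 0 T)
    {x y : ℝ} (hx : 0 < x) (hy : 0 < y) : f x = f y :=
  isOpen_Ioi.is_const_of_deriv_eq_zero (convex_Ioi (0 : ℝ)).isPreconnected
    (fun T hT => (hf T hT).differentiableAt.differentiableWithinAt)
    (fun T hT => (hf T hT).deriv) hx hy

/-- A solution of Kummer's equation is determined by its leading coefficient at infinity,
relative to a positive solution of the algebraic growth rate `T ^ c`. -/
theorem kummer_unique {β c : ℝ} {W V : ℝ → ℝ}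
    (hW : ContDiffOn ℝ 2 W (Ioi 0)) (hV : ContDiffOn ℝ 2 V (Ioi 0))
    (hWo : ∀ T : ℝ, 0 < T → T * deriv (deriv W) T - (β + T) * deriv W T + c * W T = 0)
    (hVo : ∀ T : ℝ, 0 < T → T * deriv (deriv V) T - (β + T) * deriv V T + c * V T = 0)
    (hpos : ∀ T, 0 < T → 0 < W T)
    (hWl : Tendsto (fun T : ℝ => T ^ (-c) * W T) atTop (𝓝 1))
    (hVl : Tendsto (fun T : ℝ => T ^ (-c) * V T) atTop (𝓝 1)) {T : ℝ} (hT : 0 < T) :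
    V T = W T := by
  have hq : Tendsto (fun T => V T / W T) atTop (𝓝 1) := by
    have h := hVl.div hWl one_ne_zero
    rw [div_one] at h
    refine h.congr' ?_
    filter_upwards [eventually_gt_atTop 0] with x hx
    exact mul_div_mul_left _ _ (by positivity)
  set k : ℝ → ℝ := fun x => (W x * deriv V x - deriv W x * V x) * (x ^ (-β) * Real.exp (-x))
    with hk
  have hk0 : ∀ x, 0 < x → HasDerivAt k 0 x := by
    intro x hx
    obtain ⟨w1, w2⟩ := hW.hasDerivAt_deriv_of_Ioi hx
    obtain ⟨v1, v2⟩ := hV.hasDerivAt_deriv_of_Ioi hx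
    have h := ((w1.mul v2).sub (w2.mul v1)).mul
      ((Real.hasDerivAt_rpow_const (p := -β) (Or.inl hx.ne')).mul (hasDerivAt_neg x).exp)
    refine h.congr_deriv ?_
    have a := hWo x hx
    have b := hVo x hx
    simp only [Pi.mul_apply, Pi.sub_apply, Real.rpow_sub_one hx.ne']
    field_simp
    linear_combination (x ^ (-β) * Real.exp (-x)) * (W x * b - V x * a)
  have hqd : ∀ x, 0 < x →
      HasDerivAt (fun T => V T / W T) (k 1 * (x ^ β * Real.exp x / W x ^ 2)) x := by
    intro x hx
    have h := (hV.hasDerivAt_deriv_of_Ioi hx).1.div (hW.hasDerivAt_deriv_of_Ioi hx).1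
      (hpos x hx).ne'
    refine h.congr_deriv ?_
    rw [← eq_of_hasDerivAt_zero_Ioi hk0 hx one_pos, hk]
    have := hpos x hx
    simp only [Real.rpow_neg hx.le, Real.exp_neg]
    have : x ^ β ≠ 0 := by positivity
    field_simp
  have hkz : k 1 = 0 := by
    by_contra hne
    have hbig : Tendsto (fun x : ℝ => x ^ β * Real.exp x / W x ^ 2) atTop atTop := by
      have h1 := tendsto_exp_div_rpow_atTop (2 * c - β)
      have h2 : Tendsto (fun x : ℝ => ((x ^ (-c) * W x) ^ 2)⁻¹) atTop (𝓝 1) := by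
        simpa using (hWl.pow 2).inv₀ (by norm_num)
      refine (h1.atTop_mul_pos one_pos h2).congr' ?_
      filter_upwards [eventually_gt_atTop 0] with x hx
      have := hpos x hx
      have e : x ^ (2 * c - β) = x ^ c * x ^ c / x ^ β := by
        rw [Real.rpow_sub hx, two_mul, Real.rpow_add hx]
      rw [e, Real.rpow_neg hx.le]
      have : x ^ c ≠ 0 := by positivity
      have : x ^ β ≠ 0 := by positivity
      field_simp
    have hdiff : Tendsto (fun x : ℝ => V (x + 1) / W (x + 1) - V x / W x) atTop (𝓝 0) := by
      simpa using (hq.comp (tendsto_atTop_add_const_right _ 1 tendsto_id)).sub hq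
    have hsmall : ∀ᶠ x in atTop, |V (x + 1) / W (x + 1) - V x / W x| < |k 1| := by
      have := hdiff.abs
      rw [abs_zero] at this
      exact this.eventually_lt_const (abs_pos.2 hne)
    obtain ⟨M, hM⟩ := eventually_atTop.1 (hbig.eventually_ge_atTop 1)
    obtain ⟨x, hx, hxM, hx0⟩ := (hsmall.and ((eventually_ge_atTop M).and
      (eventually_gt_atTop 0))).exists
    obtain ⟨y, hy, hyd⟩ := exists_hasDerivAt_eq_slope (fun T => V T / W T)
      (fun x => k 1 * (x ^ β * Real.exp x / W x ^ 2)) (by linarith : x < x + 1)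
      (fun z hz => (hqd z (by linarith [hz.1])).continuousAt.continuousWithinAt)
      (fun z hz => hqd z (by linarith [hz.1]))
    have hy1 := hM y (by linarith [hy.1])
    rw [add_sub_cancel_left, div_one] at hyd
    rw [← hyd, abs_mul] at hx
    have := le_abs_self (y ^ β * Real.exp y / W y ^ 2)
    nlinarith [abs_pos.2 hne]
  have hconst : Tendsto (fun T => V T / W T) atTop (𝓝 (V T / W T)) := by
    refine tendsto_const_nhds.congr' ?_
    filter_upwards [eventually_gt_atTop 0] with x hx
    refine eq_of_hasDerivAt_zero_Ioi (f := fun T => V T / W T) (fun y hy => ?_) hT hx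
    simpa [hkz] using hqd y hy
  have := tendsto_nhds_unique hconst hq
  rwa [div_eq_one_iff_eq (hpos T hT).ne'] at this

/-- For `ν > 1` and `λ ∈ [1/2, 3/2]`, Kummer's confluent hypergeometric equation
`T W'' - (1/ν + T) W' + ((1+λ)/(2ν)) W = 0` has a unique `C²` solution on `(0,∞)`
normalized by `T^(-(1+λ)/(2ν)) W(T) → 1` at `+∞`; it extends continuously to `0`
with limit `Γ(1+1/ν)/Γ(1+(1-λ)/(2ν))`. -/
theorem stmt_13 (ν lam : ℝ) (hν : 1 < ν)
    (hlam : lam ∈ Icc (1 / 2 : ℝ) (3 / 2)) :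
    ∃ W : ℝ → ℝ,
      (ContDiffOn ℝ 2 W (Ioi 0) ∧
        (∀ T : ℝ, 0 < T →
          T * deriv (deriv W) T - (1 / ν + T) * deriv W T
            + (1 + lam) / (2 * ν) * W T = 0) ∧
        Tendsto (fun T : ℝ => T ^ (-((1 + lam) / (2 * ν))) * W T) atTop (𝓝 1) ∧
        Tendsto W (𝓝[>] 0)
          (𝓝 (Real.Gamma (1 + 1 / ν) / Real.Gamma (1 + (1 - lam) / (2 * ν))))) ∧
      ∀ W₂ : ℝ → ℝ,
        (ContDiffOn ℝ 2 W₂ (Ioi 0) ∧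
          (∀ T : ℝ, 0 < T →
            T * deriv (deriv W₂) T - (1 / ν + T) * deriv W₂ T
              + (1 + lam) / (2 * ν) * W₂ T = 0) ∧
          Tendsto (fun T : ℝ => T ^ (-((1 + lam) / (2 * ν))) * W₂ T) atTop (𝓝 1)) →
        ∀ T : ℝ, 0 < T → W₂ T = W T := by
  obtain ⟨hl1, hl2⟩ := hlam
  have hν0 : 0 < ν := by linarith
  set c := (1 + lam) / (2 * ν) with hc
  set α := 1 + (1 - lam) / (2 * ν) with hα
  have hc0 : 0 < c := div_pos (by linarith) (by linarith)
  have hα0 : 0 < α := by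
    have : α = (2 * ν + (1 - lam)) / (2 * ν) := by rw [hα]; field_simp
    rw [this]
    exact div_pos (by linarith) (by linarith)
  have hsum : α + c = 1 + 1 / ν := by rw [hα, hc]; field_simp; ring
  have hβ : 1 / ν = α + c - 1 := by linarith
  have hΓ : 0 < Real.Gamma α := Real.Gamma_pos_of_pos hα0
  set W : ℝ → ℝ := fun T => (Real.Gamma α)⁻¹ * kummerIntegral α c T with hW
  have hWc : ContDiffOn ℝ 2 W (Ioi 0) :=
    contDiffOn_const.mul (contDiffOn_kummerIntegral hα0 2 c)
  have hWo : ∀ T : ℝ, 0 < T →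
      T * deriv (deriv W) T - (1 / ν + T) * deriv W T + c * W T = 0 := by
    intro T hT
    have d1 : deriv W = fun x => (Real.Gamma α)⁻¹ * deriv (kummerIntegral α c) x :=
      funext fun x => deriv_const_mul_field _
    rw [d1, deriv_const_mul_field, hβ]
    linear_combination (Real.Gamma α)⁻¹ * kummerIntegral_ode hα0 hT c
  have hWl : Tendsto (fun T : ℝ => T ^ (-c) * W T) atTop (𝓝 1) := by
    have h := (tendsto_kummerIntegral_atTop hα0 hc0).const_mul (Real.Gamma α)⁻¹
    rw [inv_mul_cancel₀ hΓ.ne'] at h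
    exact h.congr fun T => mul_left_comm _ _ _
  refine ⟨W, ⟨hWc, hWo, hWl, ?_⟩, ?_⟩
  · have h := (tendsto_kummerIntegral_zero hα0 hc0).const_mul (Real.Gamma α)⁻¹
    rwa [hsum, inv_mul_eq_div] at h
  · rintro V ⟨hVc, hVo, hVl⟩ T hT
    exact kummer_unique hWc hVc hWo hVo
      (fun T hT => mul_pos (inv_pos.2 hΓ) (kummerIntegral_pos hα0 hT c)) hWl hVl hT
end

section
/- Let Λ > 0 and C₀ ≥ 0, let K : [0, ∞) → [0, ∞) be a continuous non-decreasing function, and let u : [0, ∞) → [0, ∞) be a C¹ function with u(0) > 0, u'(t) ≥ 0 for all t ≥ 0, and (u'(t))² ≤ Λ²·u(t)² + C₀ + 2·∫₀^t K(s)·u'(s) ds for all t ≥ 0. Then for all t ≥ 0, u(t) ≤ ( √(u(0)) + Λ⁻¹·√(C₀/u(0)) + 2^(−1/2)·∫₀^t √(K(s)·e^(−Λ·s)) ds )² · e^(Λ·t). -/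
open Set

theorem integral_mul_deriv_le_of_monotoneOn {K u u' : ℝ → ℝ}
    (hKcont : ContinuousOn K (Ici 0)) (hKmono : MonotoneOn K (Ici 0))
    (hderiv : ∀ t : ℝ, 0 ≤ t → HasDerivWithinAt u (u' t) (Ici 0) t)
    (hu'cont : ContinuousOn u' (Ici 0)) (hu'pos : ∀ t : ℝ, 0 ≤ t → 0 ≤ u' t)
    {t : ℝ} (ht : 0 ≤ t) :
    ∫ s in (0 : ℝ)..t, K s * u' s ≤ K t * (u t - u 0) := by
  have hsub : uIcc 0 t ⊆ Ici 0 := by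
    rw [uIcc_of_le ht]; exact Icc_subset_Ici_self
  have hint : IntervalIntegrable u' MeasureTheory.volume 0 t :=
    (hu'cont.mono hsub).intervalIntegrable
  have hftc : ∫ s in (0 : ℝ)..t, u' s = u t - u 0 := by
    refine intervalIntegral.integral_eq_sub_of_hasDeriv_right_of_le ht
      (fun x hx => ((hderiv x hx.1).continuousWithinAt).mono Icc_subset_Ici_self)
      (fun x hx => (hderiv x hx.1.le).mono fun y hy => (hx.1.trans hy).le) hint
  rw [← hftc, ← intervalIntegral.integral_const_mul]
  refine intervalIntegral.integral_mono_on ht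
    ((hKcont.mul hu'cont).mono hsub).intervalIntegrable (hint.const_mul _) fun s hs => ?_
  exact mul_le_mul_of_nonneg_right (hKmono hs.1 ht hs.2) (hu'pos s hs.1)

theorem le_add_sqrt_add_sqrt_of_sq_le {x a b c : ℝ} (ha : 0 ≤ a) (hb : 0 ≤ b) (hc : 0 ≤ c)
    (h : x ^ 2 ≤ a ^ 2 + b + c) : x ≤ a + √b + √c := by
  have h1 := Real.sq_sqrt hb
  have h2 := Real.sq_sqrt hc
  have h3 := Real.sqrt_nonneg b
  have h4 := Real.sqrt_nonneg c
  refine le_of_sq_le_sq ?_ (by positivity)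
  nlinarith [mul_nonneg ha h3, mul_nonneg ha h4, mul_nonneg h3 h4]

/-- Duhamel-type Gronwall inequality: if `u ≥ 0` is `C¹` on `[0,∞)` with `u(0) > 0`,
`u' ≥ 0` and `(u')² ≤ Λ² u² + C₀ + 2 ∫₀ᵗ K u'`, then
`u(t) ≤ (√(u 0) + Λ⁻¹ √(C₀/u 0) + 2^(-1/2) ∫₀ᵗ √(K e^(-Λ s)))² e^(Λ t)`. -/
theorem stmt_16 (Λ C₀ : ℝ) (hΛ : 0 < Λ) (hC₀ : 0 ≤ C₀)
    (K : ℝ → ℝ) (hKpos : ∀ t : ℝ, 0 ≤ t → 0 ≤ K t)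
    (hKcont : ContinuousOn K (Ici 0))
    (hKmono : MonotoneOn K (Ici 0))
    (u u' : ℝ → ℝ) (hupos : ∀ t : ℝ, 0 ≤ t → 0 ≤ u t)
    (hderiv : ∀ t : ℝ, 0 ≤ t → HasDerivWithinAt u (u' t) (Ici 0) t)
    (hu'cont : ContinuousOn u' (Ici 0))
    (hu0 : 0 < u 0) (hu'pos : ∀ t : ℝ, 0 ≤ t → 0 ≤ u' t)
    (hineq : ∀ t : ℝ, 0 ≤ t →
      u' t ^ 2 ≤ Λ ^ 2 * u t ^ 2 + C₀ + 2 * ∫ s in (0 : ℝ)..t, K s * u' s) :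
    ∀ t : ℝ, 0 ≤ t →
      u t ≤ (Real.sqrt (u 0) + Λ⁻¹ * Real.sqrt (C₀ / u 0)
          + (2 : ℝ) ^ (-(1 / 2) : ℝ)
            * ∫ s in (0 : ℝ)..t, Real.sqrt (K s * Real.exp (-Λ * s))) ^ 2
        * Real.exp (Λ * t) := by
  intro t ht
  have hucont : ContinuousOn u (Ici 0) := fun x hx => (hderiv x hx).continuousWithinAt
  have humono : MonotoneOn u (Ici 0) := by
    refine monotoneOn_of_hasDerivWithinAt_nonneg (convex_Ici 0) hucont (f' := u') ?_ ?_
    · intro x hx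
      exact (hderiv x (interior_subset hx)).mono interior_subset
    · intro x hx
      exact hu'pos x (interior_subset hx)
  have hu_ge : ∀ s, 0 ≤ s → u 0 ≤ u s := fun s hs => humono self_mem_Ici hs hs
  have hc : (2 : ℝ) ^ (-(1 / 2) : ℝ) = (√2)⁻¹ := by
    rw [Real.rpow_neg zero_le_two, Real.sqrt_eq_rpow]
  have hu'le : ∀ s, 0 ≤ s → u' s ≤ Λ * u s + √C₀ + √(2 * K s * u s) := by
    intro s hs
    have hI := integral_mul_deriv_le_of_monotoneOn hKcont hKmono hderiv hu'cont hu'pos hs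
    have hK := hKpos s hs
    have hu := hupos s hs
    refine le_add_sqrt_add_sqrt_of_sq_le (by positivity) hC₀ (by positivity) ?_
    nlinarith [hineq s hs, mul_nonneg hK hu0.le]
  -- extend the integrand continuously to the whole line
  set g : ℝ → ℝ := fun s => √(K (max s 0) * Real.exp (-Λ * s)) with hg
  have hgcont : Continuous g := by
    have : Continuous fun s : ℝ => K (max s 0) :=
      hKcont.comp_continuous (by fun_prop) fun s => le_max_right s 0
    exact (this.mul (by fun_prop)).sqrt
  have hgI : ∫ s in (0 : ℝ)..t, √(K s * Real.exp (-Λ * s)) = ∫ s in (0 : ℝ)..t, g s := by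
    refine intervalIntegral.integral_congr fun s hs => ?_
    rw [uIcc_of_le ht] at hs
    simp only [hg, max_eq_left hs.1]
  rw [hc, hgI]
  set A := √(C₀ / u 0) with hA
  have hA0 : 0 ≤ A := Real.sqrt_nonneg _
  have hGder : ∀ x, HasDerivAt (fun x => ∫ s in (0 : ℝ)..x, g s) (g x) x := fun x =>
    intervalIntegral.integral_hasDerivAt_right (hgcont.intervalIntegrable _ _)
      (hgcont.stronglyMeasurableAtFilter _ _) hgcont.continuousAt
  have hE : ∀ x, HasDerivAt (fun x => Real.exp (-Λ / 2 * x))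
      (Real.exp (-Λ / 2 * x) * (-Λ / 2)) x := fun x => by
    simpa using ((hasDerivAt_id x).const_mul (-Λ / 2)).exp
  have hD : ∀ x, 0 ≤ x → HasDerivWithinAt
      (fun x => -(Λ⁻¹ * A) * Real.exp (-Λ / 2 * x) + (√2)⁻¹ * (∫ s in (0 : ℝ)..x, g s)
        - √(u x) * Real.exp (-Λ / 2 * x))
      (-(Λ⁻¹ * A) * (Real.exp (-Λ / 2 * x) * (-Λ / 2)) + (√2)⁻¹ * g x
        - (u' x / (2 * √(u x)) * Real.exp (-Λ / 2 * x)
          + √(u x) * (Real.exp (-Λ / 2 * x) * (-Λ / 2)))) (Ici 0) x := by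
    intro x hx
    have hne : u x ≠ 0 := (hu0.trans_le (hu_ge x hx)).ne'
    exact ((((hE x).const_mul _).add ((hGder x).const_mul _)).hasDerivWithinAt).sub
      (((hderiv x hx).sqrt hne).mul (hE x).hasDerivWithinAt)
  have hmono := monotoneOn_of_hasDerivWithinAt_nonneg (convex_Ici 0)
    (fun x hx => (hD x hx).continuousWithinAt)
    (fun x hx => (hD x (interior_subset hx)).mono interior_subset) (by
      intro x hx
      replace hx : 0 ≤ x := interior_subset hx
      have hux : 0 < u x := hu0.trans_le (hu_ge x hx)
      have hv : 0 < √(u x) := Real.sqrt_pos.2 hux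
      have hsq : √(u x) * √(u x) = u x := Real.mul_self_sqrt hux.le
      have hgx : g x = √(K x) * Real.exp (-Λ / 2 * x) := by
        simp only [hg, max_eq_left hx]
        rw [Real.sqrt_mul (hKpos x hx), ← Real.exp_half]
        ring_nf
      have h2 : √(2 * K x * u x) = √2 * √(K x) * √(u x) := by
        rw [Real.sqrt_mul (mul_nonneg zero_le_two (hKpos x hx)), Real.sqrt_mul zero_le_two]
      have hC : √C₀ ≤ A * √(u x) := by
        rw [hA, ← Real.sqrt_mul (by positivity)]
        refine Real.sqrt_le_sqrt ?_
        rw [div_mul_eq_mul_div, le_div_iff₀ hu0]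
        exact mul_le_mul_of_nonneg_left (hu_ge x hx) hC₀
      have hs2 : (√2)⁻¹ = √2 / 2 := by
        rw [inv_eq_one_div, div_eq_div_iff (by positivity) two_ne_zero]
        norm_num
      have hkey : u' x / (2 * √(u x)) ≤ Λ / 2 * √(u x) + A / 2 + (√2)⁻¹ * √(K x) := by
        rw [div_le_iff₀ (by positivity), hs2]
        have := hu'le x hx
        rw [h2] at this
        nlinarith
      have := mul_le_mul_of_nonneg_right hkey (Real.exp_pos (-Λ / 2 * x)).le
      rw [hgx]
      have hcancel : -(Λ⁻¹ * A) * (Real.exp (-Λ / 2 * x) * (-Λ / 2))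
          = A / 2 * Real.exp (-Λ / 2 * x) := by
        field_simp
      rw [hcancel]
      linarith)
  have hfin := hmono self_mem_Ici ht ht
  simp only [mul_zero, Real.exp_zero, mul_one, intervalIntegral.integral_same] at hfin
  have hW : √(u t) * Real.exp (-Λ / 2 * t)
      ≤ √(u 0) + Λ⁻¹ * A + (√2)⁻¹ * ∫ s in (0 : ℝ)..t, g s := by
    have : 0 ≤ Λ⁻¹ * A * Real.exp (-Λ / 2 * t) := by positivity
    linarith
  calc u t = (√(u t) * Real.exp (-Λ / 2 * t)) ^ 2 * Real.exp (Λ * t) := by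
        rw [mul_pow, Real.sq_sqrt (hupos t ht), ← Real.exp_nat_mul, mul_assoc, ← Real.exp_add]
        have : ((2 : ℕ) : ℝ) * (-Λ / 2 * t) + Λ * t = 0 := by push_cast; ring
        rw [this, Real.exp_zero, mul_one]
    _ ≤ _ := by gcongr
end

section
/- Let 0 < Λ < L and K ≥ 0, and let u : [0, ∞) → [0, ∞) be a C¹ function with u(0) = 0, u'(t) ≥ 0 for all t ≥ 0, and (u'(t))² ≤ Λ²·u(t)² + 2·K·∫₀^t e^(L·s)·u'(s) ds for all t ≥ 0. Then for all t ≥ 0: u(t) ≤ (2K/(L − Λ)²)·e^(L·t) and u'(t) ≤ (2K/(L − Λ))·√(1 + Λ²/(L − Λ)²)·e^(L·t). -/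
open Set

/-- A nonnegative derivative `u'` weighted by `e^(L s)` integrates to at most `e^(L t) u(t)`. -/
theorem integral_exp_mul_deriv_le {L : ℝ} (hL : 0 ≤ L) {u u' : ℝ → ℝ}
    (hderiv : ∀ t : ℝ, 0 ≤ t → HasDerivWithinAt u (u' t) (Ici 0) t)
    (hu'cont : ContinuousOn u' (Ici 0))
    (hu0 : u 0 = 0) (hu'pos : ∀ t : ℝ, 0 ≤ t → 0 ≤ u' t) {t : ℝ} (ht : 0 ≤ t) :
    ∫ s in (0 : ℝ)..t, Real.exp (L * s) * u' s ≤ Real.exp (L * t) * u t := by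
  have hc : ContinuousOn u' (Icc 0 t) := hu'cont.mono Icc_subset_Ici_self
  have hi : IntervalIntegrable u' MeasureTheory.volume 0 t :=
    hc.intervalIntegrable_of_Icc ht
  have hexp : ContinuousOn (fun s => Real.exp (L * s) * u' s) (Icc 0 t) :=
    ContinuousOn.mul (by fun_prop) hc
  have hu : ∫ s in (0 : ℝ)..t, u' s = u t := by
    rw [intervalIntegral.integral_eq_sub_of_hasDeriv_right_of_le ht
      (fun s hs => ((hderiv s hs.1).continuousWithinAt).mono Icc_subset_Ici_self)
      (fun s hs => (hderiv s hs.1.le).mono fun y hy => hs.1.le.trans (le_of_lt hy)) hi,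
      hu0, sub_zero]
  rw [← hu, ← intervalIntegral.integral_const_mul]
  refine intervalIntegral.integral_mono_on ht (hexp.intervalIntegrable_of_Icc ht)
    (hi.const_mul _) fun s hs => ?_
  exact mul_le_mul_of_nonneg_right
    (Real.exp_le_exp.2 (mul_le_mul_of_nonneg_left hs.2 hL)) (hu'pos s hs.1)

/-- A solution of `(u')² ≤ Λ² u² + 2K e^(L t) u` starting from zero stays below `C e^(L t)` as soon
as `2K < (L² - Λ²) C`. -/
theorem le_mul_exp_of_sq_deriv_le {Λ L K C : ℝ} (hL : 0 ≤ L) (hC : 0 < C)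
    (hKC : 2 * K < (L ^ 2 - Λ ^ 2) * C) {u u' : ℝ → ℝ}
    (hderiv : ∀ t : ℝ, 0 ≤ t → HasDerivWithinAt u (u' t) (Ici 0) t) (hu0 : u 0 = 0)
    (hineq : ∀ t : ℝ, 0 ≤ t →
      u' t ^ 2 ≤ Λ ^ 2 * u t ^ 2 + 2 * K * (Real.exp (L * t) * u t)) {t : ℝ} (ht : 0 ≤ t) :
    u t ≤ C * Real.exp (L * t) := by
  have hB : ∀ x, HasDerivAt (fun x => C * Real.exp (L * x)) (C * (Real.exp (L * x) * L)) x :=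
    fun x => by simpa using (((hasDerivAt_id x).const_mul L).exp).const_mul C
  refine image_le_of_deriv_right_lt_deriv_boundary (a := 0) (b := t) (f := u) (f' := u')
    (fun s hs => ((hderiv s hs.1).continuousWithinAt).mono Icc_subset_Ici_self)
    (fun s hs => (hderiv s hs.1).mono (Ici_subset_Ici.2 hs.1))
    (by simpa [hu0] using hC.le) hB (fun s hs hus => ?_) (right_mem_Icc.2 ht)
  have h := hineq s hs.1
  rw [hus] at h
  have he := Real.exp_pos (L * s)
  refine lt_of_pow_lt_pow_left₀ 2 (by positivity) (h.trans_lt ?_)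
  have := mul_lt_mul_of_pos_left hKC (show 0 < C * Real.exp (L * s) ^ 2 by positivity)
  linarith



/-- Duhamel principle with zero initial data: if `u ≥ 0` is `C¹` on `[0,∞)`,
`u(0) = 0`, `u' ≥ 0` and `(u')² ≤ Λ² u² + 2K ∫₀ᵗ e^(L s) u'` with `0 < Λ < L`,
then `u(t) ≤ (2K/(L-Λ)²) e^(L t)` and
`u'(t) ≤ (2K/(L-Λ)) √(1 + Λ²/(L-Λ)²) e^(L t)`. -/
theorem stmt_17 (Λ L K : ℝ) (hΛ : 0 < Λ) (hΛL : Λ < L) (hK : 0 ≤ K)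
    (u u' : ℝ → ℝ) (hupos : ∀ t : ℝ, 0 ≤ t → 0 ≤ u t)
    (hderiv : ∀ t : ℝ, 0 ≤ t → HasDerivWithinAt u (u' t) (Ici 0) t)
    (hu'cont : ContinuousOn u' (Ici 0))
    (hu0 : u 0 = 0) (hu'pos : ∀ t : ℝ, 0 ≤ t → 0 ≤ u' t)
    (hineq : ∀ t : ℝ, 0 ≤ t →
      u' t ^ 2 ≤ Λ ^ 2 * u t ^ 2
        + 2 * K * ∫ s in (0 : ℝ)..t, Real.exp (L * s) * u' s) :
    ∀ t : ℝ, 0 ≤ t →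
      u t ≤ 2 * K / (L - Λ) ^ 2 * Real.exp (L * t) ∧
      u' t ≤ 2 * K / (L - Λ) * Real.sqrt (1 + Λ ^ 2 / (L - Λ) ^ 2)
        * Real.exp (L * t) := by
  have hL : 0 ≤ L := (hΛ.trans hΛL).le
  have hd : 0 < L - Λ := sub_pos.2 hΛL
  set M := 2 * K / (L - Λ) ^ 2 with hM
  have hM0 : 0 ≤ M := by positivity
  have hMK : 2 * K = M * (L - Λ) ^ 2 := by rw [hM]; field_simp
  have hineq' : ∀ t : ℝ, 0 ≤ t →
      u' t ^ 2 ≤ Λ ^ 2 * u t ^ 2 + 2 * K * (Real.exp (L * t) * u t) := fun t ht =>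
    (hineq t ht).trans (by
      gcongr
      exact integral_exp_mul_deriv_le hL hderiv hu'cont hu0 hu'pos ht)
  intro t ht
  have he := Real.exp_pos (L * t)
  have hut : u t ≤ M * Real.exp (L * t) := by
    rw [← div_le_iff₀ he]
    refine le_of_forall_gt_imp_ge_of_dense fun C hC => ?_
    rw [div_le_iff₀ he]
    have hC0 : 0 < C := hM0.trans_lt hC
    refine le_mul_exp_of_sq_deriv_le hL hC0 ?_ hderiv hu0 hineq' ht
    have h1 : M * (L - Λ) ^ 2 ≤ C * (L - Λ) ^ 2 := by gcongr
    have h2 : 0 < C * (Λ * (L - Λ)) := by positivity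
    rw [hMK]
    linarith
  refine ⟨hut, ?_⟩
  have hK' : 2 * K / (L - Λ) = M * (L - Λ) := by rw [hM]; field_simp
  rw [hK']
  refine le_of_pow_le_pow_left₀ two_ne_zero (by positivity) ?_
  have hu := hupos t ht
  calc u' t ^ 2 ≤ Λ ^ 2 * u t ^ 2 + 2 * K * (Real.exp (L * t) * u t) := hineq' t ht
    _ ≤ Λ ^ 2 * (M * Real.exp (L * t)) ^ 2
        + 2 * K * (Real.exp (L * t) * (M * Real.exp (L * t))) := by gcongr
    _ = _ := by
      rw [mul_pow, mul_pow, mul_pow, Real.sq_sqrt (by positivity), hMK]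
      field_simp
      ring
end

section
/- Let Λ > 0, C₀ ≥ 0 and M ≥ 0, and let u : [0, ∞) → [0, ∞) be a C¹ function with u'(t) ≥ 0 for all t ≥ 0 and (u'(t))² ≤ Λ²·u(t)² + C₀ + 2·M·e^(Λ·t)·u(t) for all t ≥ 0. Then for all t ≥ 0, u(t) ≤ Λ⁻¹·( √(C₀) + M·t + Λ·u(0) )·e^(Λ·t). -/
open Set

/-- Gronwall step for mixed modes: if `u ≥ 0` is `C¹` on `[0,∞)` with `u' ≥ 0` and
`(u')² ≤ Λ² u² + C₀ + 2 M e^(Λ t) u`, then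
`u(t) ≤ Λ⁻¹ (√C₀ + M t + Λ u(0)) e^(Λ t)`. -/
theorem stmt_18 (Λ C₀ M : ℝ) (hΛ : 0 < Λ) (hC₀ : 0 ≤ C₀) (hM : 0 ≤ M)
    (u u' : ℝ → ℝ) (hupos : ∀ t : ℝ, 0 ≤ t → 0 ≤ u t)
    (hderiv : ∀ t : ℝ, 0 ≤ t → HasDerivWithinAt u (u' t) (Ici 0) t)
    (hu'cont : ContinuousOn u' (Ici 0))
    (hu'pos : ∀ t : ℝ, 0 ≤ t → 0 ≤ u' t)
    (hineq : ∀ t : ℝ, 0 ≤ t →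
      u' t ^ 2 ≤ Λ ^ 2 * u t ^ 2 + C₀ + 2 * M * Real.exp (Λ * t) * u t) :
    ∀ t : ℝ, 0 ≤ t →
      u t ≤ Λ⁻¹ * (Real.sqrt C₀ + M * t + Λ * u 0) * Real.exp (Λ * t) := by
  have hsqrt := Real.sqrt_nonneg C₀
  have hbound : ∀ t : ℝ, 0 ≤ t →
      u' t ≤ Λ * u t + M / Λ * Real.exp (Λ * t) + Real.sqrt C₀ := by
    intro t ht
    have hu := mul_nonneg hΛ.le (hupos t ht)
    have he : 0 ≤ M / Λ * Real.exp (Λ * t) := by positivity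
    refine le_of_abs_le (abs_le_of_sq_le_sq ?_ (by positivity))
    have hcross : Λ * u t * (M / Λ * Real.exp (Λ * t)) = M * Real.exp (Λ * t) * u t := by
      field_simp
    nlinarith [hineq t ht, Real.sq_sqrt hC₀, mul_nonneg hsqrt hu, mul_nonneg hsqrt he,
      sq_nonneg (M / Λ * Real.exp (Λ * t))]
  have hexp : ∀ t : ℝ, HasDerivAt (fun s => Real.exp (-(Λ * s))) (Real.exp (-(Λ * t)) * -Λ) t := by
    intro t
    simpa using (((hasDerivAt_id t).const_mul Λ).neg).exp
  have hg : ∀ t : ℝ, 0 ≤ t → HasDerivWithinAt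
      (fun s => (u s + Real.sqrt C₀ / Λ) * Real.exp (-(Λ * s)) - M / Λ * s)
      (u' t * Real.exp (-(Λ * t)) + (u t + Real.sqrt C₀ / Λ) * (Real.exp (-(Λ * t)) * -Λ)
        - M / Λ) (Ici 0) t := by
    intro t ht
    simpa only [id_eq, mul_one] using (((hderiv t ht).add_const (Real.sqrt C₀ / Λ)).fun_mul
      (hexp t).hasDerivWithinAt).fun_sub
        (((hasDerivAt_id' t).const_mul (M / Λ)).hasDerivWithinAt)
  have hanti := antitoneOn_of_hasDerivWithinAt_nonpos (convex_Ici (0 : ℝ))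
    (fun t ht => (hg t ht).continuousWithinAt)
    (fun t ht => (hg t (interior_subset ht)).mono interior_subset) (by
      intro t ht
      have h := mul_le_mul_of_nonneg_right (hbound t (interior_subset ht))
        (Real.exp_nonneg (-(Λ * t)))
      have hone : Real.exp (Λ * t) * Real.exp (-(Λ * t)) = 1 := by
        rw [← Real.exp_add]; simp
      have hcancel : Real.sqrt C₀ / Λ * Λ = Real.sqrt C₀ := div_mul_cancel₀ _ hΛ.ne'
      linear_combination h + M / Λ * hone - Real.exp (-(Λ * t)) * hcancel)
  intro t ht
  have h := hanti self_mem_Ici ht ht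
  simp only [mul_zero, neg_zero, Real.exp_zero, mul_one, sub_zero] at h
  rw [← div_le_iff₀ (Real.exp_pos _), div_eq_mul_inv, ← Real.exp_neg]
  have hrhs : Λ⁻¹ * (Real.sqrt C₀ + M * t + Λ * u 0) =
      u 0 + Real.sqrt C₀ / Λ + M / Λ * t := by
    field_simp
    ring
  have hnonneg : 0 ≤ Real.sqrt C₀ / Λ * Real.exp (-(Λ * t)) := by positivity
  rw [hrhs]
  linarith
end

section
/- Let C > 0, γ > 0, δ ∈ (0, 1) and N ∈ ℕ with (N + 1)·γ > 17·C. Let h : [0, ∞) → [0, ∞) be a differentiable function with h(0) = 0 and h'(t) ≤ C·(1 + h(t))⁴·h(t) + C·δ^(N+1)·e^((N+1)·γ·t) for all t ≥ 0. Then for all t ∈ [0, (1/γ)·ln(1/δ)], one has h(t) ≤ δ^(N+1)·e^((N+1)·γ·t). -/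
open Set

/-- Final bootstrap lemma: if `h ≥ 0` is differentiable on `[0,∞)` with `h(0) = 0`
and `h' ≤ C (1+h)⁴ h + C δ^(N+1) e^((N+1)γt)`, where `0 < C`, `0 < γ`,
`δ ∈ (0,1)` and `(N+1)γ > 17C`, then `h(t) ≤ δ^(N+1) e^((N+1)γt)` on
`[0, (1/γ) ln(1/δ)]`. -/
theorem stmt_19 (C γ δ : ℝ) (N : ℕ) (hC : 0 < C) (hγ : 0 < γ)
    (hδ : 0 < δ) (hδ1 : δ < 1) (hNγ : 17 * C < ((N : ℝ) + 1) * γ)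
    (h h' : ℝ → ℝ) (hpos : ∀ t : ℝ, 0 ≤ t → 0 ≤ h t)
    (hderiv : ∀ t : ℝ, 0 ≤ t → HasDerivWithinAt h (h' t) (Ici 0) t)
    (h0 : h 0 = 0)
    (hineq : ∀ t : ℝ, 0 ≤ t →
      h' t ≤ C * (1 + h t) ^ 4 * h t
        + C * δ ^ (N + 1) * Real.exp (((N : ℝ) + 1) * γ * t)) :
    ∀ t : ℝ, 0 ≤ t → t ≤ 1 / γ * Real.log (1 / δ) →
      h t ≤ δ ^ (N + 1) * Real.exp (((N : ℝ) + 1) * γ * t) := by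
  intro t ht htT
  set B : ℝ → ℝ := fun s => δ ^ (N + 1) * Real.exp (((N : ℝ) + 1) * γ * s) with hB
  have hBpos (s : ℝ) : 0 < B s := by positivity
  have hB1 (s : ℝ) (hs : s ≤ t) : B s ≤ 1 := by
    have hγs : γ * s ≤ Real.log (1 / δ) := by
      calc γ * s ≤ γ * (1 / γ * Real.log (1 / δ)) := by gcongr; exact hs.trans htT
        _ = Real.log (1 / δ) := by field_simp
    have hexp : Real.exp (γ * s) ≤ 1 / δ := by
      calc Real.exp (γ * s) ≤ Real.exp (Real.log (1 / δ)) := Real.exp_le_exp.2 hγs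
        _ = 1 / δ := Real.exp_log (by positivity)
    have hBs : B s = (δ * Real.exp (γ * s)) ^ (N + 1) := by
      rw [mul_pow, ← Real.exp_nat_mul, hB]
      push_cast
      ring_nf
    rw [hBs]
    refine pow_le_one₀ (by positivity) ?_
    rwa [le_div_iff₀' hδ] at hexp
  have hBderiv (s : ℝ) : HasDerivAt B (((N : ℝ) + 1) * γ * B s) s := by
    have hd := (((hasDerivAt_id s).const_mul (((N : ℝ) + 1) * γ)).exp).const_mul (δ ^ (N + 1))
    refine hd.congr_deriv ?_
    simp only [hB, id]
    ring
  refine image_le_of_deriv_right_lt_deriv_boundary' (f := h) (f' := h') (a := 0) (b := t)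
    (B := B) (B' := fun s => ((N : ℝ) + 1) * γ * B s) ?_ ?_ ?_ ?_ ?_ ?_ (right_mem_Icc.2 ht)
  · exact fun s hs => (hderiv s hs.1).continuousWithinAt.mono Icc_subset_Ici_self
  · exact fun s hs => (hderiv s hs.1).mono (Ici_subset_Ici.2 hs.1)
  · exact h0.trans_le (hBpos 0).le
  · exact fun s _ => (hBderiv s).continuousAt.continuousWithinAt
  · exact fun s _ => (hBderiv s).hasDerivWithinAt
  · intro s hs hsB
    have hBs := hBpos s
    have hpow : (1 + B s) ^ 4 ≤ 16 := by
      calc (1 + B s) ^ 4 ≤ (1 + 1) ^ 4 := by gcongr; exact hB1 s hs.2.le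
        _ = 16 := by norm_num
    calc h' s ≤ C * (1 + B s) ^ 4 * B s + C * B s := by
          simpa only [hsB, hB, mul_assoc] using hineq s hs.1
      _ ≤ C * 16 * B s + C * B s := by gcongr
      _ = 17 * C * B s := by ring
      _ < ((N : ℝ) + 1) * γ * B s := by gcongr
end
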